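/- arXiv:hep-th/0301115 — 2 statements merged into one kernel-verified Lean document; each statement's English description precedes it below -/
import Mathlib

section
/- Let K be a compact subset of the open right half-plane {z ∈ ℂ : Re z > 0} and let ε > 0. Then for each choice of sign there exists a polynomial q with complex coefficients such that sup_{z ∈ K} |e^{±iz} − z·q(z²)| < ε. In other words, e^{±iz} can be uniformly approximated on K by polynomials in z containing only odd powers of z. -/
noncomputable section

open Complex Filter Topology Metric

/-- A closed subalgebra of `C(X, ℂ)` is stable under the holomorphic functional calculus on discs. -/
lemma Subalgebra.mem_of_eq_comp_of_differentiableOn_ball {X : Type*} [TopologicalSpace X]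
    [CompactSpace X] {S : Subalgebra ℂ C(X, ℂ)} (hS : IsClosed (S : Set C(X, ℂ)))
    {a b : C(X, ℂ)} (ha : a ∈ S) {h : ℂ → ℂ} {R : ℝ} (hh : DifferentiableOn ℂ h (ball 0 R))
    (haR : ‖a‖ < R) (hb : ∀ x, b x = h (a x)) : b ∈ S := by
  obtain ⟨r, har, hrR⟩ := exists_between haR
  obtain ⟨s, has, hsr⟩ := exists_between har
  have hs : 0 ≤ s := (norm_nonneg a).trans has.le
  lift s to NNReal using hs
  have hr : 0 ≤ r := s.coe_nonneg.trans hsr.le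
  lift r to NNReal using hr
  have hsr' : s < r := by exact_mod_cast hsr
  have hp := (hh.mono (closedBall_subset_ball hrR)).hasFPowerSeriesOnBall
    (lt_of_le_of_lt zero_le hsr')
  have hu := hp.tendstoUniformlyOn (ENNReal.coe_lt_coe.2 hsr')
  set p := cauchyPowerSeries h 0 r
  refine hS.mem_of_tendsto (f := fun n : ℕ => ∑ i ∈ Finset.range n, p.coeff i • a ^ i)
    (b := atTop) ?_ (Eventually.of_forall fun n =>
      S.sum_mem fun i _ => S.smul_mem (S.pow_mem ha i) _)
  rw [ContinuousMap.tendsto_iff_tendstoUniformly, Metric.tendstoUniformly_iff]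
  intro ε hε
  filter_upwards [Metric.tendstoUniformlyOn_iff.1 hu ε hε] with n hn x
  have hx := hn (a x) (by simpa using (a.norm_coe_le_norm x).trans_lt has)
  rw [hb]
  convert! hx using 2
  · simp
  · simp [FormalMultilinearSeries.partialSum, mul_comm]

/-- The principal logarithm of a quotient of points of the slit plane lying in a common closed
half-plane bounded by the real axis. -/
lemma Complex.log_div_of_sub_ofReal {w : ℂ} {s : ℝ} (hw : w ∈ slitPlane)
    (hws : w - s ∈ slitPlane) : log ((w - s) / w) = log (w - s) - log w := by
  have hπ := Real.pi_pos
  have hwa := mem_slitPlane_iff_arg.1 hw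
  have hva := mem_slitPlane_iff_arg.1 hws
  rw [div_eq_mul_inv, (log_mul_eq_add_log_iff hva.2 (inv_ne_zero hwa.2)).2, log_inv _ hwa.1,
    ← sub_eq_add_neg]
  rw [arg_inv, if_neg hwa.1]
  have hw1 := (arg_le_pi w).lt_of_ne hwa.1
  have hv1 := (arg_le_pi (w - s)).lt_of_ne hva.1
  have hw2 := neg_pi_lt_arg w
  have hv2 := neg_pi_lt_arg (w - s)
  have him : (w - s).im = w.im := by simp
  rcases lt_or_ge w.im 0 with hneg | hnonneg
  · have h1 := arg_neg_iff.2 hneg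
    have h2 := arg_neg_iff.2 (him.trans_lt hneg)
    constructor <;> linarith
  · have h1 := arg_nonneg_iff.2 hnonneg
    have h2 := arg_nonneg_iff.2 (hnonneg.trans_eq him.symm)
    constructor <;> linarith

lemma Complex.sq_add_ofReal_mem_slitPlane {z : ℂ} (hz : 0 < z.re) {t : ℝ} (ht : 0 ≤ t) :
    z ^ 2 + t ∈ slitPlane := by
  rw [mem_slitPlane_iff]
  by_cases him : z.im = 0
  · left
    simp only [sq, add_re, mul_re, him, ofReal_re]
    nlinarith
  · right
    have : (z ^ 2 + t).im = 2 * (z.re * z.im) := by simp [sq]; ring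
    rw [this]
    exact mul_ne_zero two_ne_zero (mul_ne_zero hz.ne' him)

lemma Complex.sq_le_norm_sq_add_ofReal {z : ℂ} {m : ℝ} (hm : 0 ≤ m) (hz : m ≤ z.re) {t : ℝ}
    (ht : 0 ≤ t) : m ^ 2 ≤ ‖z ^ 2 + t‖ := by
  have hfac : z ^ 2 + t = (z - √t * I) * (z + √t * I) := by
    have h : ((√t : ℝ) : ℂ) ^ 2 = t := by exact_mod_cast congrArg ofReal (Real.sq_sqrt ht)
    linear_combination -h + (√t : ℂ) ^ 2 * I_sq
  have h1 : m ≤ ‖z - √t * I‖ := hz.trans (by simpa using re_le_norm (z - √t * I))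
  have h2 : m ≤ ‖z + √t * I‖ := hz.trans (by simpa using re_le_norm (z + √t * I))
  rw [hfac, norm_mul, sq]
  exact mul_le_mul h1 h2 hm (norm_nonneg _)

section RightHalfPlane

variable {K : Set ℂ}

/-- The function `z ↦ log (z ^ 2 + t)` on a subset of the right half-plane. -/
def logSqAdd (hKre : ∀ z ∈ K, 0 < z.re) (t : ℝ) (ht : 0 ≤ t) : C(K, ℂ) where
  toFun z := log ((z : ℂ) ^ 2 + t)
  continuous_toFun := Continuous.clog (by fun_prop)
    fun z => sq_add_ofReal_mem_slitPlane (hKre z z.2) ht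

/-- The square function on a set of complex numbers. -/
def sqMap (K : Set ℂ) : C(K, ℂ) where
  toFun z := (z : ℂ) ^ 2

variable [CompactSpace K] {S : Subalgebra ℂ C(K, ℂ)}

lemma differentiableOn_log_one_add : DifferentiableOn ℂ (fun x : ℂ => log (1 + x)) (ball 0 1) :=
  fun x hx => (DifferentiableAt.clog (by fun_prop)
    (mem_slitPlane_of_norm_lt_one (by simpa using hx))).differentiableWithinAt

lemma logSqAdd_mem_of_norm_lt (hKre : ∀ z ∈ K, 0 < z.re) (hS : IsClosed (S : Set C(K, ℂ)))
    (hsq : sqMap K ∈ S) {t : ℝ} (ht : ‖sqMap K‖ < t) :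
    logSqAdd hKre t ((norm_nonneg _).trans ht.le) ∈ S := by
  have ht0 : 0 < t := (norm_nonneg _).trans_lt ht
  have htC : (t : ℂ) ≠ 0 := ofReal_ne_zero.2 ht0.ne'
  have ha : (t : ℂ)⁻¹ • sqMap K ∈ S := S.smul_mem hsq _
  have hnorm : ‖(t : ℂ)⁻¹ • sqMap K‖ < 1 := by
    rw [norm_smul, norm_inv, norm_real, Real.norm_of_nonneg ht0.le, inv_mul_lt_one₀ ht0]
    exact ht
  refine Subalgebra.mem_of_eq_comp_of_differentiableOn_ball hS ha
    (h := fun x => Real.log t + log (1 + x)) (differentiableOn_log_one_add.const_add _) hnorm ?_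
  intro z
  have hne : 1 + ((t : ℂ)⁻¹ • sqMap K) z ≠ 0 := slitPlane_ne_zero <|
    mem_slitPlane_of_norm_lt_one ((ContinuousMap.norm_coe_le_norm _ z).trans_lt hnorm)
  rw [← log_ofReal_mul ht0 hne]
  simp only [logSqAdd, sqMap, ContinuousMap.coe_mk, ContinuousMap.smul_apply, smul_eq_mul]
  congr 1
  field_simp
  ring

lemma logSqAdd_mem_of_add (hKre : ∀ z ∈ K, 0 < z.re) (hS : IsClosed (S : Set C(K, ℂ)))
    {m s t : ℝ} (hm : 0 < m) (hmK : ∀ z ∈ K, m ≤ z.re) (hs : 0 ≤ s) (hsm : s < m ^ 2)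
    (ht : 0 ≤ t) (hmem : logSqAdd hKre (t + s) (add_nonneg ht hs) ∈ S) :
    logSqAdd hKre t ht ∈ S := by
  set g := logSqAdd hKre (t + s) (add_nonneg ht hs) with hg
  have hslit (z : K) := sq_add_ofReal_mem_slitPlane (hKre z z.2) (add_nonneg ht hs)
  let e : C(K, ℂ) := ⟨fun z => -s * ((z : ℂ) ^ 2 + (t + s : ℝ))⁻¹,
    continuous_const.mul (Continuous.inv₀ (by fun_prop) fun z => slitPlane_ne_zero (hslit z))⟩
  have he : e ∈ S := by
    refine Subalgebra.mem_of_eq_comp_of_differentiableOn_ball hS hmem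
      (h := fun x => -s * exp (-x)) (R := ‖g‖ + 1)
      (Differentiable.differentiableOn (by fun_prop)) (lt_add_one _) ?_
    intro z
    simp only [e, hg, logSqAdd, ContinuousMap.coe_mk]
    rw [exp_neg, exp_log (slitPlane_ne_zero (hslit z))]
  have hnorm : ‖e‖ < 1 := by
    rw [ContinuousMap.norm_lt_iff _ one_pos]
    intro z
    have hle := sq_le_norm_sq_add_ofReal hm.le (hmK z z.2) (add_nonneg ht hs)
    simp only [e, ContinuousMap.coe_mk]
    rw [norm_mul, norm_neg, norm_real, Real.norm_of_nonneg hs, norm_inv, ← div_eq_mul_inv,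
      div_lt_one ((pow_pos hm 2).trans_le hle)]
    exact hsm.trans_le hle
  have hlog : logSqAdd hKre t ht - g ∈ S := by
    refine Subalgebra.mem_of_eq_comp_of_differentiableOn_ball hS he
      differentiableOn_log_one_add hnorm ?_
    intro z
    have hsub : (z : ℂ) ^ 2 + (t + s : ℝ) - s = (z : ℂ) ^ 2 + t := by push_cast; ring
    have hdiv := log_div_of_sub_ofReal (s := s) (hslit z)
      (hsub ▸ sq_add_ofReal_mem_slitPlane (hKre z z.2) ht)
    have hne := slitPlane_ne_zero (hslit z)
    rw [sub_div, div_self hne] at hdiv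
    simp only [e, hg, logSqAdd, ContinuousMap.coe_mk, ContinuousMap.sub_apply]
    rw [← hsub, ← hdiv]
    congr 1
    ring
  simpa using S.add_mem hlog hmem

lemma logSqAdd_mem (hKre : ∀ z ∈ K, 0 < z.re) (hS : IsClosed (S : Set C(K, ℂ)))
    (hsq : sqMap K ∈ S) (t : ℝ) (ht : 0 ≤ t) : logSqAdd hKre t ht ∈ S := by
  obtain ⟨m, hm, hmK⟩ : ∃ m : ℝ, 0 < m ∧ ∀ z ∈ K, m ≤ z.re :=
    (isCompact_iff_compactSpace.2 ‹_›).exists_forall_le' continuous_re.continuousOn hKre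
  have hm2 : 0 < m ^ 2 / 2 := by positivity
  have key (n : ℕ) : ∀ t (ht : 0 ≤ t), ‖sqMap K‖ < t + n * (m ^ 2 / 2) →
      logSqAdd hKre t ht ∈ S := by
    induction n with
    | zero => exact fun t _ h => logSqAdd_mem_of_norm_lt hKre hS hsq (by simpa using h)
    | succ n ih =>
      intro t ht h
      refine logSqAdd_mem_of_add hKre hS hm hmK hm2.le (by linarith) ht (ih _ _ ?_)
      push_cast at h
      linarith
  obtain ⟨n, hn⟩ := exists_nat_gt (‖sqMap K‖ / (m ^ 2 / 2))
  rw [div_lt_iff₀ hm2] at hn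
  exact key n t ht (by linarith)

/-- A closed subalgebra of `C(K, ℂ)` containing `z ↦ z ^ 2` contains `z ↦ z⁻¹`. -/
lemma mem_of_forall_eq_inv (hKre : ∀ z ∈ K, 0 < z.re) (hS : IsClosed (S : Set C(K, ℂ)))
    (hsq : sqMap K ∈ S) {b : C(K, ℂ)} (hb : ∀ z : K, b z = (z : ℂ)⁻¹) : b ∈ S := by
  refine Subalgebra.mem_of_eq_comp_of_differentiableOn_ball hS
    (logSqAdd_mem hKre hS hsq 0 le_rfl) (h := fun x => exp (-(x / 2)))
    (Differentiable.differentiableOn (by fun_prop)) (lt_add_one _) ?_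
  intro z
  have hz : (z : ℂ) ≠ 0 := fun h => by simpa [h] using hKre z z.2
  have harg := abs_lt.1 (abs_arg_lt_pi_div_two_iff.2 (Or.inl (hKre z z.2)))
  simp only [logSqAdd, ContinuousMap.coe_mk, ofReal_zero, add_zero]
  have hlog : log ((z : ℂ) ^ 2) = 2 * log z := by
    rw [sq, (log_mul_eq_add_log_iff hz hz).2 ⟨by linarith, by linarith⟩, two_mul]
  rw [hb, hlog, mul_div_cancel_left₀ _ two_ne_zero, exp_neg, exp_log hz]

end RightHalfPlane

/-- On a compact subset K of the open right half-plane, e^{±iz} can be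
uniformly approximated by functions of the form z·q(z²) with q a polynomial
(i.e. by polynomials in z containing only odd powers of z). -/
theorem exp_approx_by_odd_polynomials
    (K : Set ℂ) (hK : IsCompact K) (hKre : ∀ z ∈ K, 0 < z.re)
    (ε : ℝ) (hε : 0 < ε) (σ : ℝ) (hσ : σ = 1 ∨ σ = -1) :
    ∃ q : Polynomial ℂ,
      (⨆ z : K, ‖Complex.exp ((σ : ℂ) * Complex.I * (z : ℂ))
        - (z : ℂ) * q.eval ((z : ℂ) ^ 2)‖) < ε := by
  have : CompactSpace K := isCompact_iff_compactSpace.1 hK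
  have hne (z : K) : (z : ℂ) ≠ 0 := fun h => by simpa [h] using hKre z z.2
  let P : Subalgebra ℂ C(K, ℂ) := (Polynomial.aeval (R := ℂ) (sqMap K)).range
  have hS : IsClosed (P.topologicalClosure : Set C(K, ℂ)) := P.isClosed_topologicalClosure
  have hsq : sqMap K ∈ P.topologicalClosure :=
    P.le_topologicalClosure ⟨Polynomial.X, by simp⟩
  let u : C(K, ℂ) := ⟨fun z => (z : ℂ)⁻¹, continuous_subtype_val.inv₀ hne⟩
  have hu : u ∈ P.topologicalClosure := mem_of_forall_eq_inv hKre hS hsq fun _ => rfl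
  let v : C(K, ℂ) := ⟨fun z => exp (σ * I * z), by fun_prop⟩
  have hv : v ∈ P.topologicalClosure := by
    refine Subalgebra.mem_of_eq_comp_of_differentiableOn_ball hS
      (P.topologicalClosure.mul_mem hsq hu) (h := fun x => exp (σ * I * x))
      (Differentiable.differentiableOn (by fun_prop)) (lt_add_one _) fun z => ?_
    have hz := hne z
    simp only [v, u, sqMap, ContinuousMap.mul_apply, ContinuousMap.coe_mk]
    field_simp
  obtain ⟨C, hC, hCK⟩ := hK.isBounded.exists_pos_norm_le
  have huv : v * u ∈ closure (P : Set C(K, ℂ)) := P.topologicalClosure.mul_mem hv hu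
  obtain ⟨_, ⟨q, rfl⟩, hq⟩ := Metric.mem_closure_iff.1 huv (ε / 2 / C) (by positivity)
  refine ⟨q, (Real.iSup_le (fun z => ?_) (half_pos hε).le).trans_lt (half_lt_self hε)⟩
  have hqz := (ContinuousMap.dist_apply_le_dist z).trans hq.le
  have heval : (Polynomial.aeval (sqMap K) q) z = q.eval ((z : ℂ) ^ 2) := by
    simp [Polynomial.aeval_eq_sum_range, Polynomial.eval_eq_sum_range, sqMap]
  have hfac : exp (σ * I * z) - z * q.eval ((z : ℂ) ^ 2) =
      z * ((v * u) z - q.eval ((z : ℂ) ^ 2)) := by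
    have hz := hne z
    simp only [v, u, ContinuousMap.mul_apply, ContinuousMap.coe_mk]
    field_simp
  rw [hfac, norm_mul, ← heval, ← dist_eq_norm]
  calc ‖(z : ℂ)‖ * _ ≤ C * (ε / 2 / C) :=
        mul_le_mul (hCK z z.2) hqz dist_nonneg hC.le
    _ = ε / 2 := mul_div_cancel₀ _ hC.ne'
end
end

section
/- Let Ξ : V₊ → ℂ be smooth with □Ξ = 0 on V₊, let B ⊆ V₊ be compact, and let ε > 0. Then there exist finitely many positive lightlike vectors l₁, …, l_N ∈ ℝ⁴, even natural numbers m₁, …, m_N, and coefficients c₁, …, c_N ∈ ℂ such that sup_{β ∈ B} | Ξ(β) − Σ_{j=1}^N c_j (l_j·β)^{m_j} | < ε. That is, the linear span of the even powers β ↦ (l·β)^m (m even, l positive lightlike) is dense in the smooth solutions of the wave equation on V₊ with respect to uniform convergence on compact subsets of V₊. -/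
noncomputable section

/-- Minkowski inner product on ℝ⁴: x·y = x₀y₀ − x₁y₁ − x₂y₂ − x₃y₃. -/
def mink (x y : Fin 4 → ℝ) : ℝ := x 0 * y 0 - x 1 * y 1 - x 2 * y 2 - x 3 * y 3

/-- Partial derivative in the ν-th coordinate direction. -/
def pd {E : Type*} [NormedAddCommGroup E] [NormedSpace ℝ E]
    (ν : Fin 4) (f : (Fin 4 → ℝ) → E) (x : Fin 4 → ℝ) : E :=
  fderiv ℝ f x (Pi.single ν 1)

/-- The d'Alembertian □ = ∂₀² − ∂₁² − ∂₂² − ∂₃². -/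
def box {E : Type*} [NormedAddCommGroup E] [NormedSpace ℝ E]
    (f : (Fin 4 → ℝ) → E) (x : Fin 4 → ℝ) : E :=
  pd 0 (pd 0 f) x - pd 1 (pd 1 f) x - pd 2 (pd 2 f) x - pd 3 (pd 3 f) x

/-- The open forward light cone V₊ = {x : x₀ > 0, x·x > 0}. -/
def Vplus : Set (Fin 4 → ℝ) := {x | 0 < x 0 ∧ 0 < mink x x}

/-- A vector l is positive lightlike if l ≠ 0, l·l = 0 and l₀ > 0. -/
def PosLightlike (l : Fin 4 → ℝ) : Prop := l ≠ 0 ∧ mink l l = 0 ∧ 0 < l 0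

open MeasureTheory Filter Topology Set
open scoped ContDiff FourierTransform

lemma exists_sum_near_of_mem_topologicalClosure_span {X : Type*} [NormedAddCommGroup X]
    [NormedSpace ℂ X] {S : Set X} {x : X} (hx : x ∈ (Submodule.span ℂ S).topologicalClosure)
    {ε : ℝ} (hε : 0 < ε) :
    ∃ (N : ℕ) (c : Fin N → ℂ) (g : Fin N → X), (∀ i, g i ∈ S) ∧ ‖x - ∑ i, c i • g i‖ < ε := by
  rw [← SetLike.mem_coe, Submodule.topologicalClosure_coe] at hx
  obtain ⟨y, hy, hd⟩ := Metric.mem_closure_iff.1 hx ε hε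
  obtain ⟨N, c, g, rfl⟩ := Submodule.mem_span_set'.1 hy
  exact ⟨N, c, fun i => g i, fun i => (g i).2, by rwa [dist_eq_norm] at hd⟩

/-- A vector which is weakly the integral of a continuous family in a closed subspace belongs
to that subspace. -/
lemma mem_of_forall_apply_eq_integral {X V ι : Type*} [NormedAddCommGroup X]
    [NormedSpace ℂ X] [CompleteSpace X] [NormedAddCommGroup V] [NormedSpace ℂ V]
    [NormedSpace ℝ V] [IsScalarTower ℝ ℂ V] [CompleteSpace V]
    {α : Type*} [TopologicalSpace α] [SecondCountableTopology α] [MeasurableSpace α]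
    [OpensMeasurableSpace α] {μ : Measure α} {W : Submodule ℂ X} (hW : IsClosed (W : Set X))
    {G : α → X} (hGW : ∀ a, G a ∈ W) (hG : Continuous G) (hint : Integrable G μ)
    (F : ι → X →L[ℂ] V) (hF : ∀ x y, (∀ i, F i x = F i y) → x = y) {x : X}
    (hx : ∀ i, F i x = ∫ a, F i (G a) ∂μ) : x ∈ W := by
  have hWc : CompleteSpace W := hW.isComplete.completeSpace_coe
  let G' : α → W := fun a => ⟨G a, hGW a⟩
  have hG' : Continuous G' := hG.subtype_mk _
  have hint' : Integrable G' μ :=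
    hint.norm.mono' hG'.aestronglyMeasurable (Eventually.of_forall fun a => le_rfl)
  have h : ∀ i, F i ((∫ a, G' a ∂μ : W) : X) = ∫ a, F i (G a) ∂μ := fun i =>
    (((F i).comp W.subtypeL).integral_comp_comm hint').symm
  rw [hF x _ fun i => (hx i).trans (h i).symm]
  exact Subtype.property _

lemma mink_pos_of_posLightlike {l β : Fin 4 → ℝ} (hl : PosLightlike l) (hβ : β ∈ Vplus) :
    0 < mink l β := by
  obtain ⟨-, hll, hl0⟩ := hl
  obtain ⟨hβ0, hββ⟩ := hβ
  simp only [mink] at *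
  have hprod : 0 < l 0 * β 0 := mul_pos hl0 hβ0
  have hcs : (l 1 * β 1 + l 2 * β 2 + l 3 * β 3) ^ 2
      ≤ (l 1 ^ 2 + l 2 ^ 2 + l 3 ^ 2) * (β 1 ^ 2 + β 2 ^ 2 + β 3 ^ 2) := by
    nlinarith [sq_nonneg (l 1 * β 2 - l 2 * β 1), sq_nonneg (l 1 * β 3 - l 3 * β 1),
      sq_nonneg (l 2 * β 3 - l 3 * β 2)]
  have hl2 : l 1 ^ 2 + l 2 ^ 2 + l 3 ^ 2 = l 0 ^ 2 := by linarith
  have hlt : (l 1 * β 1 + l 2 * β 2 + l 3 * β 3) ^ 2 < (l 0 * β 0) ^ 2 := by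
    rw [hl2] at hcs
    refine hcs.trans_lt ?_
    rw [mul_pow]
    exact mul_lt_mul_of_pos_left (by nlinarith) (by positivity)
  have := (abs_lt_of_sq_lt_sq hlt hprod.le)
  linarith [le_abs_self (l 1 * β 1 + l 2 * β 2 + l 3 * β 3), (abs_lt.1 this).2]

lemma continuous_mink_right (l : Fin 4 → ℝ) : Continuous (mink l) := by
  unfold mink
  fun_prop

/-- The even powers `β ↦ (l·β)^m`, as continuous functions on `B`. -/
def evenLightlikePowers (B : Set (Fin 4 → ℝ)) : Set C(B, ℂ) :=
  {g | ∃ (l : Fin 4 → ℝ) (m : ℕ), PosLightlike l ∧ Even m ∧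
    ∀ β : B, g β = ((mink l β ^ m : ℝ) : ℂ)}

/-- The uniform closure of the linear span of the even powers on `B`. -/
def evenLightlikeClosure (B : Set (Fin 4 → ℝ)) : Submodule ℂ C(B, ℂ) :=
  (Submodule.span ℂ (evenLightlikePowers B)).topologicalClosure

lemma real_planeWave_mem_evenLightlikeClosure {B : Set (Fin 4 → ℝ)} [CompactSpace B]
    (hBV : B ⊆ Vplus) {l : Fin 4 → ℝ} (hl : PosLightlike l) {h : ℝ → ℝ} (hh : Continuous h)
    (g : C(B, ℂ)) (hg : ∀ β : B, g β = (h (mink l β) : ℂ)) :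
    g ∈ evenLightlikeClosure B := by
  have hcont : Continuous fun β : B => mink l β ^ 2 :=
    ((continuous_mink_right l).comp continuous_subtype_val).pow 2
  obtain ⟨b, hb⟩ := (isCompact_range hcont).bddAbove
  rw [evenLightlikeClosure, ← SetLike.mem_coe, Submodule.topologicalClosure_coe,
    Metric.mem_closure_iff]
  intro ε hε
  obtain ⟨p, hp⟩ := exists_polynomial_near_of_continuousOn 0 b (fun r => h (√r))
    (hh.comp Real.continuous_sqrt).continuousOn (ε / 2) (by positivity)
  let q : ℕ → C(B, ℂ) := fun n => ⟨fun β => ((mink l β ^ (2 * n) : ℝ) : ℂ), by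
    have := (continuous_mink_right l).comp (continuous_subtype_val (p := (· ∈ B)))
    exact Complex.continuous_ofReal.comp (this.pow _)⟩
  refine ⟨∑ n ∈ Finset.range (p.natDegree + 1), (p.coeff n : ℂ) • q n, ?_, ?_⟩
  · refine Submodule.sum_mem _ fun n _ => Submodule.smul_mem _ _ (Submodule.subset_span ?_)
    exact ⟨l, 2 * n, hl, even_two_mul n, fun β => rfl⟩
  · refine lt_of_le_of_lt ?_ (half_lt_self hε)
    rw [ContinuousMap.dist_le (by positivity)]
    intro β
    have hpos := mink_pos_of_posLightlike hl (hBV β.2)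
    have hval : (∑ n ∈ Finset.range (p.natDegree + 1), (p.coeff n : ℂ) • q n) β
        = ((p.eval (mink l β ^ 2) : ℝ) : ℂ) := by
      rw [Polynomial.eval_eq_sum_range]
      simp [q, ContinuousMap.sum_apply, pow_mul]
    have := hp (mink l β ^ 2) ⟨by positivity, hb ⟨β, rfl⟩⟩
    simp only [Real.sqrt_sq hpos.le] at this
    rw [hval, hg, Complex.dist_eq, ← Complex.ofReal_sub, Complex.norm_real, Real.norm_eq_abs,
      abs_sub_comm]
    exact this.le

lemma planeWave_mem_evenLightlikeClosure {B : Set (Fin 4 → ℝ)} [CompactSpace B]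
    (hBV : B ⊆ Vplus) {l : Fin 4 → ℝ} (hl : PosLightlike l) {h : ℝ → ℂ} (hh : Continuous h)
    (g : C(B, ℂ)) (hg : ∀ β : B, g β = h (mink l β)) :
    g ∈ evenLightlikeClosure B := by
  have hre : Continuous fun r => (h r).re := Complex.continuous_re.comp hh
  have him : Continuous fun r => (h r).im := Complex.continuous_im.comp hh
  have hm := (continuous_mink_right l).comp (continuous_subtype_val (p := (· ∈ B)))
  let g₁ : C(B, ℂ) := ⟨fun β => (((h (mink l β)).re : ℝ) : ℂ),
    Complex.continuous_ofReal.comp (hre.comp hm)⟩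
  let g₂ : C(B, ℂ) := ⟨fun β => (((h (mink l β)).im : ℝ) : ℂ),
    Complex.continuous_ofReal.comp (him.comp hm)⟩
  have hsum : g = g₁ + Complex.I • g₂ := by
    ext β
    simp only [hg, ContinuousMap.add_apply, ContinuousMap.smul_apply, smul_eq_mul, g₁, g₂,
      ContinuousMap.coe_mk]
    rw [mul_comm, Complex.re_add_im]
  rw [hsum]
  exact Submodule.add_mem _
    (real_planeWave_mem_evenLightlikeClosure hBV hl hre g₁ fun β => rfl)
    (Submodule.smul_mem _ _
      (real_planeWave_mem_evenLightlikeClosure hBV hl him g₂ fun β => rfl))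

/-- Euclidean space `ℝ³`. -/
abbrev E3 := EuclideanSpace ℝ (Fin 3)

/-- The character `x ↦ exp (2πi ⟪k, x⟫)`. -/
def expWave (k x : E3) : ℂ := Complex.exp (↑(2 * Real.pi * inner ℝ k x) * Complex.I)

lemma continuous_expWave : Continuous fun p : E3 × E3 => expWave p.1 p.2 := by
  unfold expWave
  fun_prop

lemma norm_expWave (k x : E3) : ‖expWave k x‖ = 1 := Complex.norm_exp_ofReal_mul_I _

/-- The 1-jet of `expWave k` at `p.1`, as a linear form in `p.2`. -/
def jetWave (k : E3) (p : E3 × ℝ × E3) : ℂ :=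
  expWave k p.1 * (p.2.1 + 2 * Real.pi * Complex.I * (inner ℝ k p.2.2 : ℝ))

lemma continuous_jetWave : Continuous fun q : E3 × E3 × ℝ × E3 => jetWave q.1 q.2 := by
  have h1 : Continuous fun q : E3 × E3 × ℝ × E3 => expWave q.1 q.2.1 :=
    continuous_expWave.comp (continuous_fst.prodMk (continuous_fst.comp continuous_snd))
  refine h1.mul ?_
  fun_prop

lemma norm_jetWave_le (k : E3) (p : E3 × ℝ × E3) :
    ‖jetWave k p‖ ≤ |p.2.1| + 2 * Real.pi * (‖k‖ * ‖p.2.2‖) := by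
  rw [jetWave, norm_mul, norm_expWave, one_mul]
  refine (norm_add_le _ _).trans (add_le_add (by simp) ?_)
  simp only [norm_mul, Complex.norm_real, Complex.norm_I, Complex.norm_ofNat, mul_one,
    Real.norm_eq_abs, abs_of_pos Real.pi_pos]
  gcongr
  exact abs_real_inner_le_norm _ _

lemma eq_integral_fourier_mul_jetWave {φ : E3 → ℂ} (hφ : ContDiff ℝ ∞ φ)
    (hc : HasCompactSupport φ) :
    Continuous (𝓕 φ) ∧ Integrable (𝓕 φ) ∧ Integrable (fun k => ‖k‖ * ‖𝓕 φ k‖) ∧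
    ∀ p : E3 × ℝ × E3, p.2.1 * φ p.1 + fderiv ℝ φ p.1 p.2.2 = ∫ k, 𝓕 φ k * jetWave k p := by
  let ψ : SchwartzMap E3 ℂ := hc.toSchwartzMap hφ
  let ψ' : SchwartzMap E3 (E3 →L[ℝ] ℂ) := SchwartzMap.fderivCLM ℝ E3 ℂ ψ
  have hψ : ⇑ψ = φ := rfl
  have hψ' : ⇑ψ' = fderiv ℝ φ := by ext1 x; rfl
  have hFcont : Continuous (𝓕 φ) := by
    have := (𝓕 ψ).continuous
    rwa [SchwartzMap.fourier_coe] at this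
  have hFint : Integrable (𝓕 φ) := by
    have := (𝓕 ψ).integrable (μ := volume)
    rwa [SchwartzMap.fourier_coe] at this
  have hF'int : Integrable (fun k => ‖k‖ * ‖𝓕 φ k‖) := by
    have := (𝓕 ψ).integrable_pow_mul (volume) 1
    rw [SchwartzMap.fourier_coe] at this
    simpa [hψ] using this
  refine ⟨hFcont, hFint, hF'int, fun p => ?_⟩
  obtain ⟨x, a, v⟩ := p
  have hφint : Integrable φ := hφ.continuous.integrable_of_hasCompactSupport hc
  have hφ'int : Integrable (fderiv ℝ φ) := by rw [← hψ']; exact ψ'.integrable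
  have hφ'cont : Continuous (fderiv ℝ φ) := by rw [← hψ']; exact ψ'.continuous
  have hF' : 𝓕 (fderiv ℝ φ) = fun k => VectorFourier.fourierSMulRight (-innerSL ℝ) (𝓕 φ) k := by
    rw [Real.fourier_fderiv hφint (hφ.differentiable (by simp)) hφ'int]
  have hint : Integrable (𝓕 (fderiv ℝ φ)) := by
    have := (𝓕 ψ').integrable (μ := volume)
    rwa [SchwartzMap.fourier_coe, hψ'] at this
  have h1 : φ x = ∫ k, 𝓕 φ k * expWave k x := by
    have : 𝓕⁻ (𝓕 φ) = φ := Continuous.fourierInv_fourier_eq hφ.continuous hφint hFint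
    conv_lhs => rw [← this, Real.fourierInv_eq']
    simp only [expWave, smul_eq_mul, mul_comm]
  have h2 : fderiv ℝ φ x v
      = ∫ k, 𝓕 φ k * (expWave k x * (2 * Real.pi * Complex.I * (inner ℝ k v : ℝ))) := by
    have : 𝓕⁻ (𝓕 (fderiv ℝ φ)) = fderiv ℝ φ :=
      Continuous.fourierInv_fourier_eq hφ'cont hφ'int hint
    conv_lhs => rw [← this, Real.fourierInv_eq]
    have hint' : Integrable fun k : E3 => Real.fourierChar (inner ℝ k x) • 𝓕 (fderiv ℝ φ) k := by
      simpa using (Real.fourierIntegral_convergent_iff (-x)).2 hint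
    rw [ContinuousLinearMap.integral_apply hint', hF']
    congr 1
    ext k
    have hkv : innerSL ℝ k v = inner ℝ k v := rfl
    simp only [smul_apply, VectorFourier.fourierSMulRight_apply, expWave,
      Circle.smul_def, Real.fourierChar_apply, smul_eq_mul]
    simp [hkv]
    ring
  have hexp : Continuous fun k => expWave k x :=
    continuous_expWave.comp (continuous_id.prodMk continuous_const)
  have hi1 : Integrable fun k => 𝓕 φ k * expWave k x := by
    refine hFint.mono (hFcont.mul hexp).aestronglyMeasurable (Eventually.of_forall fun k => ?_)
    simp [norm_expWave]
  have hi2 : Integrable fun k =>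
      𝓕 φ k * (expWave k x * (2 * Real.pi * Complex.I * (inner ℝ k v : ℝ))) := by
    refine (hF'int.const_mul (2 * Real.pi * ‖v‖)).mono' (hFcont.mul (hexp.mul
      (by fun_prop))).aestronglyMeasurable (Eventually.of_forall fun k => ?_)
    have h := norm_jetWave_le k (x, 0, v)
    simp only [jetWave, Complex.ofReal_zero, zero_add, abs_zero] at h
    rw [norm_mul]
    calc _ ≤ ‖𝓕 φ k‖ * (2 * Real.pi * (‖k‖ * ‖v‖)) := by gcongr
      _ = _ := by ring
  simp only [jetWave]
  rw [h1, h2, ← integral_const_mul, ← integral_add (hi1.const_mul _) hi2]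
  congr 1
  ext k
  ring

lemma exists_jetWave_sum_near {φ : E3 → ℂ} (hφ : ContDiff ℝ ∞ φ) (hc : HasCompactSupport φ)
    {K : Set (E3 × ℝ × E3)} (hK : IsCompact K) {ε : ℝ} (hε : 0 < ε) :
    ∃ (N : ℕ) (c : Fin N → ℂ) (k : Fin N → E3), ∀ p ∈ K,
      ‖(p.2.1 * φ p.1 + fderiv ℝ φ p.1 p.2.2) - ∑ j, c j * jetWave (k j) p‖ ≤ ε := by
  obtain ⟨hFcont, hFint, hF'int, hF⟩ := eq_integral_fourier_mul_jetWave hφ hc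
  have hKc : CompactSpace K := isCompact_iff_compactSpace.1 hK
  obtain ⟨R, hR0, hR⟩ := hK.isBounded.exists_pos_norm_le
  have hJcont : Continuous fun p : E3 × ℝ × E3 => p.2.1 * φ p.1 + fderiv ℝ φ p.1 p.2.2 := by
    have h0 : Continuous fun p : E3 × ℝ × E3 => φ p.1 := hφ.continuous.comp continuous_fst
    have h1 : Continuous fun p : E3 × ℝ × E3 => fderiv ℝ φ p.1 :=
      (hφ.continuous_fderiv (by simp)).comp continuous_fst
    exact ((Complex.continuous_ofReal.comp (by fun_prop)).mul h0).add (h1.clm_apply (by fun_prop))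
  obtain ⟨J, hJapp⟩ : ∃ J : C(K, ℂ), ∀ p : K, J p = p.1.2.1 * φ p.1.1 + fderiv ℝ φ p.1.1 p.1.2.2 :=
    ⟨⟨_, hJcont.comp continuous_subtype_val⟩, fun p => rfl⟩
  have hGk : ∀ k, Continuous fun p : K => jetWave k p := fun k => by
    have h : Continuous fun p : K => (k, (p : E3 × ℝ × E3)) :=
      continuous_const.prodMk continuous_subtype_val
    have h' := continuous_jetWave.comp h
    exact h'
  obtain ⟨G, hGapp, hGcont⟩ : ∃ G : E3 → C(K, ℂ), (∀ k p, G k p = jetWave k p) ∧ Continuous G := by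
    have h : Continuous fun q : E3 × K => (q.1, (q.2 : E3 × ℝ × E3)) :=
      continuous_fst.prodMk (continuous_subtype_val.comp continuous_snd)
    have h' := continuous_jetWave.comp h
    exact ⟨fun k => ⟨fun p => jetWave k p, hGk k⟩, fun k p => rfl,
      ContinuousMap.continuous_of_continuous_uncurry _ h'⟩
  have hGnorm : ∀ k, ‖G k‖ ≤ R + 2 * Real.pi * (‖k‖ * R) := fun k => by
    rw [ContinuousMap.norm_le _ (by positivity)]
    intro p
    have h1 : |p.1.2.1| ≤ R :=
      ((le_max_left _ _).trans (le_max_right ‖p.1.1‖ _)).trans (hR p p.2)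
    have h2 : ‖p.1.2.2‖ ≤ R :=
      ((le_max_right _ _).trans (le_max_right ‖p.1.1‖ _)).trans (hR p p.2)
    rw [hGapp]
    refine (norm_jetWave_le k _).trans (add_le_add h1 ?_)
    gcongr
  have hJ : J ∈ (Submodule.span ℂ (range G)).topologicalClosure := by
    refine mem_of_forall_apply_eq_integral (μ := volume) (G := fun k => 𝓕 φ k • G k)
      (W := (Submodule.span ℂ (range G)).topologicalClosure)
      (Submodule.isClosed_topologicalClosure _)
      (fun k => Submodule.smul_mem _ (𝓕 φ k)
        (Submodule.le_topologicalClosure _ (Submodule.subset_span (mem_range_self k))))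
      (hFcont.smul hGcont) ?_ (fun p : K => ContinuousMap.evalCLM ℂ p)
      (fun f g h => ContinuousMap.ext h) fun p => ?_
    swap
    · simpa [hJapp, hGapp] using hF p
    refine Integrable.mono' ((hFint.norm.mul_const R).add (hF'int.const_mul (2 * Real.pi * R)))
      (hFcont.smul hGcont).aestronglyMeasurable (Eventually.of_forall fun k => ?_)
    rw [norm_smul]
    calc ‖𝓕 φ k‖ * ‖G k‖ ≤ ‖𝓕 φ k‖ * (R + 2 * Real.pi * (‖k‖ * R)) := by
          gcongr
          exact hGnorm k
      _ = _ := by simp only [Pi.add_apply]; ring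
  obtain ⟨N, c, g, hg, hd⟩ := exists_sum_near_of_mem_topologicalClosure_span hJ hε
  choose k hk using hg
  refine ⟨N, c, k, fun p hp => ?_⟩
  have h := (ContinuousMap.norm_coe_le_norm (J - ∑ i, c i • g i) ⟨p, hp⟩).trans hd.le
  simpa [← hk, ContinuousMap.sum_apply, hJapp, hGapp] using h

/-- A smooth compactly supported function on `ℝ³` is approximated in `C¹` on balls by
trigonometric sums. -/
lemma exists_expWave_sum_near {R : ℝ} (hR : 1 ≤ R) {φ : E3 → ℂ} (hφ : ContDiff ℝ ∞ φ)
    (hc : HasCompactSupport φ) {ε : ℝ} (hε : 0 < ε) :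
    ∃ (N : ℕ) (c : Fin N → ℂ) (k : Fin N → E3), ∀ x v : E3, ‖x‖ ≤ R → ‖v‖ ≤ 1 →
      ‖φ x - ∑ j, c j * expWave (k j) x‖ ≤ ε ∧
      ‖fderiv ℝ φ x v - ∑ j, c j * jetWave (k j) (x, 0, v)‖ ≤ ε := by
  obtain ⟨N, c, k, key⟩ := exists_jetWave_sum_near hφ hc
    (isCompact_closedBall (0 : E3 × ℝ × E3) R) hε
  refine ⟨N, c, k, fun x v hx hv => ?_⟩
  have h0 : (0 : ℝ) ≤ R := zero_le_one.trans hR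
  constructor
  · simpa [jetWave] using key (x, 1, 0) (by simp [Prod.norm_def, hx, hR])
  · simpa using key (x, 0, v) (by simp [Prod.norm_def, hx, hv.trans hR])

lemma hasDerivAt_integral_of_continuousOn {S : Type*} [TopologicalSpace S] [CompactSpace S]
    [MeasurableSpace S] [OpensMeasurableSpace S] (μ : Measure S) [IsFiniteMeasure μ]
    {O : Set (ℝ × S)} (hO : IsOpen O) {F F' : ℝ → S → ℂ}
    (hF : ContinuousOn (fun p : ℝ × S => F p.1 p.2) O)
    (hF' : ContinuousOn (fun p : ℝ × S => F' p.1 p.2) O)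
    (hd : ∀ p ∈ O, HasDerivAt (fun s => F s p.2) (F' p.1 p.2) p.1) {s₀ : ℝ}
    (hs₀ : ∀ σ, (s₀, σ) ∈ O) :
    HasDerivAt (fun s => ∫ σ, F s σ ∂μ) (∫ σ, F' s₀ σ ∂μ) s₀ := by
  obtain ⟨U, V, hU, -, hsU, hV, hUV⟩ := generalized_tube_lemma (isCompact_singleton (x := s₀))
    (isCompact_univ (X := S)) hO (by rintro ⟨a, b⟩ ⟨rfl, -⟩; exact hs₀ b)
  obtain ⟨r, hr, hrU⟩ := Metric.nhds_basis_closedBall.mem_iff.1 (hU.mem_nhds (hsU rfl))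
  have hmem : ∀ s ∈ Metric.closedBall s₀ r, ∀ σ, (s, σ) ∈ O := fun s hs σ =>
    hUV ⟨hrU hs, hV (mem_univ σ)⟩
  have hcont : ∀ {H : ℝ → S → ℂ}, ContinuousOn (fun p : ℝ × S => H p.1 p.2) O →
      ∀ s ∈ Metric.closedBall s₀ r, Continuous (H s) := fun {H} hH s hs =>
    continuousOn_univ.1 (hH.comp (f := fun σ => (s, σ)) (by fun_prop) fun σ _ => hmem s hs σ)
  obtain ⟨C, hC⟩ := ((isCompact_closedBall s₀ r).prod
    (isCompact_univ (X := S))).exists_bound_of_continuousOn (hF'.mono fun p hp => hmem p.1 hp.1 p.2)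
  have hs := Metric.mem_closedBall_self (x := s₀) hr.le
  refine (hasDerivAt_integral_of_dominated_loc_of_deriv_le (bound := fun _ => C)
    (Metric.closedBall_mem_nhds s₀ hr) ?_ ?_ (hcont hF' s₀ hs).aestronglyMeasurable
    (ae_of_all _ fun σ s hs => hC (s, σ) ⟨hs, mem_univ _⟩) (integrable_const C)
    (ae_of_all _ fun σ s hs => hd (s, σ) (hmem s hs σ))).2
  · filter_upwards [Metric.closedBall_mem_nhds s₀ hr] with s hs
    exact (hcont hF s hs).aestronglyMeasurable
  · have hc := hcont hF s₀ hs
    exact hc.integrable_of_hasCompactSupport (HasCompactSupport.of_compactSpace _)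

/-- Rotation by the angle `θ` in the plane spanned by `e` and `f`. -/
def planeRotation (e f : E3) (θ : ℝ) : E3 →ₗ[ℝ] E3 where
  toFun x := x + ((Real.cos θ - 1) * inner ℝ e x - Real.sin θ * inner ℝ f x) • e
    + (Real.sin θ * inner ℝ e x + (Real.cos θ - 1) * inner ℝ f x) • f
  map_add' x y := by simp only [inner_add_right]; module
  map_smul' c x := by simp only [inner_smul_right, RingHom.id_apply]; module

lemma norm_planeRotation {e f : E3} (he : ‖e‖ = 1) (hf : ‖f‖ = 1) (hef : inner ℝ e f = 0)
    (θ : ℝ) (x : E3) : ‖planeRotation e f θ x‖ = ‖x‖ := by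
  rw [← sq_eq_sq₀ (norm_nonneg _) (norm_nonneg _), ← real_inner_self_eq_norm_sq,
    ← real_inner_self_eq_norm_sq]
  have hee : inner ℝ e e = (1 : ℝ) := by rw [real_inner_self_eq_norm_sq, he]; norm_num
  have hff : inner ℝ f f = (1 : ℝ) := by rw [real_inner_self_eq_norm_sq, hf]; norm_num
  have hfe : inner ℝ f e = 0 := by rw [real_inner_comm, hef]
  simp only [planeRotation, LinearMap.coe_mk, AddHom.coe_mk, inner_add_left, inner_add_right,
    inner_smul_left, inner_smul_right, hee, hff, hef, hfe, real_inner_comm e x,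
    real_inner_comm f x, RCLike.conj_to_real]
  linear_combination (inner ℝ e x ^ 2 + inner ℝ f x ^ 2) * Real.sin_sq_add_cos_sq θ

open scoped Pointwise in
lemma toSphere_rotation_invariant (R : E3 ≃ₗᵢ[ℝ] E3) {ρ : Metric.sphere (0 : E3) 1 →
    Metric.sphere (0 : E3) 1} (hρ : ∀ σ, (ρ σ : E3) = R σ) :
    MeasurePreserving ρ (volume : Measure E3).toSphere (volume : Measure E3).toSphere := by
  have hc : Continuous ρ := by
    rw [continuous_induced_rng]
    exact (R.continuous.comp continuous_subtype_val).congr fun σ => (hρ σ).symm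
  refine ⟨hc.measurable, ?_⟩
  ext s hs
  rw [Measure.map_apply hc.measurable hs, Measure.toSphere_apply' _ hs,
    Measure.toSphere_apply' _ (hc.measurable hs)]
  congr 1
  rw [← R.measurePreserving.measure_preimage_equiv (f := R.toMeasurableEquiv)
    (Ioo (0 : ℝ) 1 • (((↑) : Metric.sphere (0 : E3) 1 → E3) '' s))]
  congr 1
  ext x
  simp only [Set.mem_smul, mem_preimage]
  constructor
  · rintro ⟨a, ha, -, ⟨σ, hσ, rfl⟩, rfl⟩
    exact ⟨a, ha, _, ⟨ρ σ, hσ, rfl⟩, by simp [hρ]⟩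
  · rintro ⟨a, ha, -, ⟨σ, hσ, rfl⟩, hx⟩
    let τ : Metric.sphere (0 : E3) 1 := ⟨R.symm σ, by simp⟩
    have hτ : ρ τ = σ := Subtype.ext (by rw [hρ]; exact R.apply_symm_apply σ)
    refine ⟨a, ha, τ, ⟨τ, ?_, rfl⟩, ?_⟩
    · rwa [mem_preimage, hτ]
    · apply R.injective
      simpa [τ] using hx

lemma integral_sphere_fderiv_rotation_eq_zero {e f : E3} (he : ‖e‖ = 1) (hf : ‖f‖ = 1)
    (hef : inner ℝ e f = 0) {O : Set E3} (hO : IsOpen O) (hS : Metric.sphere 0 1 ⊆ O)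
    {h : E3 → ℂ} (hh : ContDiffOn ℝ 1 h O) :
    ∫ σ : Metric.sphere (0 : E3) 1,
      fderiv ℝ h σ ((inner ℝ e (σ : E3) : ℝ) • f - (inner ℝ f (σ : E3) : ℝ) • e)
        ∂(volume : Measure E3).toSphere = 0 := by
  set μ := (volume : Measure E3).toSphere
  have hcontR : Continuous fun p : ℝ × Metric.sphere (0 : E3) 1 =>
      planeRotation e f p.1 p.2 := by
    simp only [planeRotation, LinearMap.coe_mk, AddHom.coe_mk]
    fun_prop
  have hmem : ∀ (θ : ℝ) (σ : Metric.sphere (0 : E3) 1), planeRotation e f θ σ ∈ O := fun θ σ =>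
    hS (by simp [norm_planeRotation he hf hef])
  have hinv : ∀ θ : ℝ, ∫ σ : Metric.sphere (0 : E3) 1, h (planeRotation e f θ σ) ∂μ
      = ∫ σ : Metric.sphere (0 : E3) 1, h σ ∂μ := fun θ => by
    let R : E3 ≃ₗᵢ[ℝ] E3 := LinearIsometry.toLinearIsometryEquiv
      ⟨planeRotation e f θ, norm_planeRotation he hf hef θ⟩ rfl
    let ρ : Metric.sphere (0 : E3) 1 → Metric.sphere (0 : E3) 1 := fun σ =>
      ⟨R σ, by rw [mem_sphere_zero_iff_norm, R.norm_map, norm_eq_of_mem_sphere]⟩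
    have hρ := toSphere_rotation_invariant R (ρ := ρ) fun _ => rfl
    have hc : Continuous fun σ : Metric.sphere (0 : E3) 1 => h σ :=
      hh.continuousOn.comp_continuous continuous_subtype_val fun σ => hS σ.2
    have hmap := integral_map (μ := μ) hρ.measurable.aemeasurable hc.aestronglyMeasurable
    rw [hρ.map_eq] at hmap
    exact hmap.symm
  have hd := hasDerivAt_integral_of_continuousOn μ (O := univ) isOpen_univ (s₀ := 0)
    (F := fun θ σ => h (planeRotation e f θ σ))
    (F' := fun θ σ => fderiv ℝ h (planeRotation e f θ σ)
      ((-Real.sin θ * inner ℝ e (σ : E3) - Real.cos θ * inner ℝ f (σ : E3)) • e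
        + (Real.cos θ * inner ℝ e (σ : E3) - Real.sin θ * inner ℝ f (σ : E3)) • f))
    (hh.continuousOn.comp hcontR.continuousOn fun p _ => hmem p.1 p.2)
    (((hh.continuousOn_fderiv_of_isOpen hO le_rfl).comp hcontR.continuousOn
      fun p _ => hmem p.1 p.2).clm_apply (by fun_prop)) ?_ (fun _ => mem_univ _)
  · simp only [hinv] at hd
    have := hd.unique (hasDerivAt_const _ _)
    rw [← this]
    refine integral_congr_ae (ae_of_all _ fun σ => ?_)
    simp [planeRotation, neg_add_eq_sub]
  · rintro ⟨θ, σ⟩ -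
    have h1 := ((hh.differentiableOn one_ne_zero).differentiableAt
      (hO.mem_nhds (hmem θ σ))).hasFDerivAt
    refine h1.comp_hasDerivAt θ ?_
    simp only [planeRotation, LinearMap.coe_mk, AddHom.coe_mk]
    have hc := Real.hasDerivAt_cos θ
    have hs := Real.hasDerivAt_sin θ
    exact ((((hc.sub_const 1).mul_const _).sub (hs.mul_const _)).smul_const e).const_add _ |>.add
      (((hs.mul_const _).add ((hc.sub_const 1).mul_const _)).smul_const f) |>.congr_deriv (by module)

/-- The inclusion of space `ℝ³` in space-time `ℝ⁴`. -/
def spaceIncl : E3 →L[ℝ] (Fin 4 → ℝ) :=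
  LinearMap.toContinuousLinearMap
    { toFun := fun x => ![0, x 0, x 1, x 2]
      map_add' := fun x y => by ext i; fin_cases i <;> simp
      map_smul' := fun c x => by ext i; fin_cases i <;> simp }

lemma spaceIncl_apply (x : E3) : spaceIncl x = ![0, x 0, x 1, x 2] := rfl

/-- The unit vector in the time direction. -/
def timeVec : Fin 4 → ℝ := Pi.single 0 1

lemma norm_sq_E3 (x : E3) : ‖x‖ ^ 2 = x 0 ^ 2 + x 1 ^ 2 + x 2 ^ 2 := by
  rw [EuclideanSpace.norm_sq_eq, Fin.sum_univ_three]
  simp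

lemma posLightlike_timeVec_add_spaceIncl {x : E3} (hx : ‖x‖ = 1) :
    PosLightlike (timeVec + spaceIncl x) := by
  have h := norm_sq_E3 x
  rw [hx] at h
  refine ⟨fun h0 => ?_, ?_, ?_⟩
  · simpa [timeVec, spaceIncl_apply] using congrFun h0 0
  · simp [mink, timeVec, spaceIncl_apply]
    linarith
  · simp [timeVec, spaceIncl_apply]

lemma isOpen_Vplus : IsOpen Vplus := by
  have h0 : IsOpen {x : Fin 4 → ℝ | 0 < x 0} := isOpen_lt (by fun_prop) (by fun_prop)
  have h1 : IsOpen {x : Fin 4 → ℝ | 0 < mink x x} :=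
    isOpen_lt (by fun_prop) (by unfold mink; fun_prop)
  exact h0.inter h1

lemma add_smul_mem_Vplus {β l : Fin 4 → ℝ} (hβ : β ∈ Vplus) (hl : PosLightlike l) {s : ℝ}
    (hs : 0 ≤ s) : β + s • l ∈ Vplus := by
  have h := mink_pos_of_posLightlike hl hβ
  obtain ⟨-, hll, hl0⟩ := hl
  refine ⟨?_, ?_⟩
  · simp only [Pi.add_apply, Pi.smul_apply, smul_eq_mul]
    have := hβ.1
    positivity
  · have : mink (β + s • l) (β + s • l) = mink β β + 2 * s * mink l β + s ^ 2 * mink l l := by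
      simp only [mink, Pi.add_apply, Pi.smul_apply, smul_eq_mul]
      ring
    rw [this, hll]
    have := hβ.2
    positivity

/-- The generator of the rotations in the plane spanned by `e` and `f`. -/
def rotationGenerator (e f : E3) : E3 →L[ℝ] E3 :=
  (innerSL ℝ e).smulRight f - (innerSL ℝ f).smulRight e

lemma rotationGenerator_apply (e f x : E3) :
    rotationGenerator e f x = (inner ℝ e x : ℝ) • f - (inner ℝ f x : ℝ) • e := rfl

lemma pd_pd_eq_fderiv_fderiv {u : (Fin 4 → ℝ) → ℂ} {x : Fin 4 → ℝ}
    (hu : DifferentiableAt ℝ (fderiv ℝ u) x) (i j : Fin 4) :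
    pd i (pd j u) x = fderiv ℝ (fderiv ℝ u) x (Pi.single i 1) (Pi.single j 1) := by
  unfold pd
  rw [fderiv_clm_apply hu (differentiableAt_const _)]
  simp

lemma contDiffOn_fderiv_Vplus {u : (Fin 4 → ℝ) → ℂ} (hu : ContDiffOn ℝ ∞ u Vplus) :
    ContDiffOn ℝ ∞ (fderiv ℝ u) Vplus :=
  hu.fderiv_of_isOpen isOpen_Vplus (by simp)

lemma hasFDerivAt_fderiv_Vplus {u : (Fin 4 → ℝ) → ℂ} (hu : ContDiffOn ℝ ∞ u Vplus)
    {x : Fin 4 → ℝ} (hx : x ∈ Vplus) :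
    HasFDerivAt (fderiv ℝ u) (fderiv ℝ (fderiv ℝ u) x) x :=
  (((contDiffOn_fderiv_Vplus hu).differentiableOn (by simp)).differentiableAt
    (isOpen_Vplus.mem_nhds hx)).hasFDerivAt

lemma continuousOn_fderiv_fderiv_Vplus {u : (Fin 4 → ℝ) → ℂ} (hu : ContDiffOn ℝ ∞ u Vplus) :
    ContinuousOn (fderiv ℝ (fderiv ℝ u)) Vplus :=
  ((contDiffOn_fderiv_Vplus hu).fderiv_of_isOpen (m := 0) isOpen_Vplus (by simp)).continuousOn

lemma fderiv_fderiv_comm_Vplus {u : (Fin 4 → ℝ) → ℂ} (hu : ContDiffOn ℝ ∞ u Vplus)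
    {x : Fin 4 → ℝ} (hx : x ∈ Vplus) (v w : Fin 4 → ℝ) :
    fderiv ℝ (fderiv ℝ u) x v w = fderiv ℝ (fderiv ℝ u) x w v :=
  (hu.contDiffAt (isOpen_Vplus.mem_nhds hx)) |>.isSymmSndFDerivAt
    (by simpa using WithTop.coe_le_coe.2 (le_top (a := (2 : ℕ∞)))) v w

lemma integral_sphere_rotationGenerator_eq_zero {u : (Fin 4 → ℝ) → ℂ}
    (hu : ContDiffOn ℝ ∞ u Vplus) {β : Fin 4 → ℝ} {s : ℝ}
    (hβ : ∀ σ : Metric.sphere (0 : E3) 1, β + s • (timeVec + spaceIncl σ) ∈ Vplus)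
    {e f : E3} (he : ‖e‖ = 1) (hf : ‖f‖ = 1) (hef : inner ℝ e f = 0) :
    ∫ σ : Metric.sphere (0 : E3) 1,
      (s * fderiv ℝ (fderiv ℝ u) (β + s • (timeVec + spaceIncl σ))
          (spaceIncl (rotationGenerator e f σ)) (spaceIncl (rotationGenerator e f σ))
        + fderiv ℝ u (β + s • (timeVec + spaceIncl σ))
          (spaceIncl (rotationGenerator e f (rotationGenerator e f σ))))
        ∂(volume : Measure E3).toSphere = 0 := by
  have hγ : ContDiff ℝ ∞ fun x : E3 => β + s • (timeVec + spaceIncl x) := by fun_prop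
  rw [← integral_sphere_fderiv_rotation_eq_zero he hf hef
    (O := {x | β + s • (timeVec + spaceIncl x) ∈ Vplus})
    (h := fun x => fderiv ℝ u (β + s • (timeVec + spaceIncl x))
      (spaceIncl (rotationGenerator e f x)))
    (isOpen_Vplus.preimage hγ.continuous) (fun σ hσ => hβ ⟨σ, hσ⟩)]
  · refine integral_congr_ae (ae_of_all _ fun σ => ?_)
    have h1 : HasFDerivAt (fun x : E3 => β + s • (timeVec + spaceIncl x)) (s • spaceIncl) (σ : E3) :=
      ((spaceIncl.hasFDerivAt.const_add timeVec).const_smul s).const_add β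
    have h2 := ((hasFDerivAt_fderiv_Vplus hu (hβ σ)).comp (σ : E3) h1).clm_apply
      (spaceIncl.comp (rotationGenerator e f)).hasFDerivAt
    have h3 := h2.fderiv
    simp only [ContinuousLinearMap.comp_apply, Function.comp_def] at h3
    simp only [← rotationGenerator_apply, h3]
    simp [add_comm]
  · refine (((contDiffOn_fderiv_Vplus hu).comp hγ.contDiffOn fun x hx => hx).clm_apply
      (by fun_prop)).of_le (by simp)

lemma sum_rotationGenerator_eq {σ : E3} (hσ : ‖σ‖ = 1) (s : ℝ)
    (Q : (Fin 4 → ℝ) →L[ℝ] (Fin 4 → ℝ) →L[ℝ] ℂ) (L : (Fin 4 → ℝ) →L[ℝ] ℂ)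
    (hQ : ∀ v w, Q v w = Q w v)
    (hbox : Q (Pi.single 0 1) (Pi.single 0 1) - Q (Pi.single 1 1) (Pi.single 1 1)
      - Q (Pi.single 2 1) (Pi.single 2 1) - Q (Pi.single 3 1) (Pi.single 3 1) = 0)
    {T : E3 → E3 → ℂ} (hT : ∀ e f, T e f = s * Q (spaceIncl (rotationGenerator e f σ))
      (spaceIncl (rotationGenerator e f σ))
      + L (spaceIncl (rotationGenerator e f (rotationGenerator e f σ)))) :
    L (timeVec + spaceIncl σ) + (L (spaceIncl σ - timeVec)
      + s * Q (timeVec + spaceIncl σ) (spaceIncl σ - timeVec))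
    = -(T (EuclideanSpace.single 0 1) (EuclideanSpace.single 1 1)
      + T (EuclideanSpace.single 0 1) (EuclideanSpace.single 2 1)
      + T (EuclideanSpace.single 1 1) (EuclideanSpace.single 2 1)) := by
  have hincl : ∀ x : E3, spaceIncl x = x 0 • Pi.single 1 1 + x 1 • Pi.single 2 1
      + x 2 • Pi.single 3 1 := fun x => by
    ext i; fin_cases i <;> simp [spaceIncl_apply]
  have h1 : ((σ 0 : ℝ) : ℂ) ^ 2 + ((σ 1 : ℝ) : ℂ) ^ 2 + ((σ 2 : ℝ) : ℂ) ^ 2 = 1 := by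
    have := norm_sq_E3 σ
    rw [hσ] at this
    exact_mod_cast this.symm.trans (one_pow 2)
  rw [hT, hT, hT]
  simp only [hincl, timeVec, rotationGenerator_apply]
  simp [EuclideanSpace.inner_single_left]
  rw [hQ (Pi.single 2 1) (Pi.single 1 1), hQ (Pi.single 3 1) (Pi.single 1 1),
    hQ (Pi.single 3 1) (Pi.single 2 1), hQ (Pi.single 1 1) (Pi.single 0 1),
    hQ (Pi.single 2 1) (Pi.single 0 1), hQ (Pi.single 3 1) (Pi.single 0 1)]
  linear_combination (s : ℂ) * (Q (Pi.single 1 1) (Pi.single 1 1)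
    + Q (Pi.single 2 1) (Pi.single 2 1) + Q (Pi.single 3 1) (Pi.single 3 1)) * h1 - s * hbox

lemma hasDerivAt_kirchhoff_integrand {u : (Fin 4 → ℝ) → ℂ} (hu : ContDiffOn ℝ ∞ u Vplus)
    {β v w : Fin 4 → ℝ} {s : ℝ} (hs : β + s • v ∈ Vplus) :
    HasDerivAt (fun s : ℝ => u (β + s • v) + s * fderiv ℝ u (β + s • v) w)
      (fderiv ℝ u (β + s • v) v + (fderiv ℝ u (β + s • v) w
        + s * fderiv ℝ (fderiv ℝ u) (β + s • v) v w)) s := by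
  have hγ : HasDerivAt (fun s : ℝ => β + s • v) v s := by
    simpa using ((hasDerivAt_id s).smul_const v).const_add β
  have h1 : HasDerivAt (fun s : ℝ => u (β + s • v)) (fderiv ℝ u (β + s • v) v) s :=
    ((hu.differentiableOn (by simp)).differentiableAt
      (isOpen_Vplus.mem_nhds hs)).hasFDerivAt.comp_hasDerivAt s hγ
  have h2 : HasDerivAt (fun s : ℝ => fderiv ℝ u (β + s • v))
      (fderiv ℝ (fderiv ℝ u) (β + s • v) v) s :=
    (hasFDerivAt_fderiv_Vplus hu hs).comp_hasDerivAt s hγ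
  have h3 : HasDerivAt (fun s : ℝ => fderiv ℝ u (β + s • v) w)
      (fderiv ℝ (fderiv ℝ u) (β + s • v) v w) s := by
    simpa using h2.clm_apply (hasDerivAt_const s w)
  have h4 : HasDerivAt (fun s : ℝ => (s : ℂ)) 1 s := Complex.ofRealCLM.hasDerivAt
  simpa using h1.fun_add (h4.fun_mul h3)

lemma integral_kirchhoff_deriv_eq_zero {u : (Fin 4 → ℝ) → ℂ} (hu : ContDiffOn ℝ ∞ u Vplus)
    (hbox : ∀ x ∈ Vplus, box u x = 0) {β : Fin 4 → ℝ} {s : ℝ}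
    (hβ : ∀ σ : Metric.sphere (0 : E3) 1, β + s • (timeVec + spaceIncl σ) ∈ Vplus) :
    ∫ σ : Metric.sphere (0 : E3) 1,
      (fderiv ℝ u (β + s • (timeVec + spaceIncl σ)) (timeVec + spaceIncl σ)
        + (fderiv ℝ u (β + s • (timeVec + spaceIncl σ)) (spaceIncl σ - timeVec)
        + s * fderiv ℝ (fderiv ℝ u) (β + s • (timeVec + spaceIncl σ)) (timeVec + spaceIncl σ)
          (spaceIncl σ - timeVec))) ∂(volume : Measure E3).toSphere = 0 := by
  let T : E3 → E3 → Metric.sphere (0 : E3) 1 → ℂ := fun e f σ =>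
    s * fderiv ℝ (fderiv ℝ u) (β + s • (timeVec + spaceIncl σ))
        (spaceIncl (rotationGenerator e f σ)) (spaceIncl (rotationGenerator e f σ))
      + fderiv ℝ u (β + s • (timeVec + spaceIncl σ))
        (spaceIncl (rotationGenerator e f (rotationGenerator e f σ)))
  have hγ : Continuous fun σ : Metric.sphere (0 : E3) 1 =>
    β + s • (timeVec + spaceIncl σ) := by fun_prop
  have hD1 := (contDiffOn_fderiv_Vplus hu).continuousOn.comp_continuous hγ hβ
  have hD2 := (continuousOn_fderiv_fderiv_Vplus hu).comp_continuous hγ hβ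
  have hint : ∀ e f, Integrable (T e f) (volume : Measure E3).toSphere := fun e f => by
    have hc : Continuous (T e f) := by
      refine (continuous_const.mul ((hD2.clm_apply ?_).clm_apply ?_)).add (hD1.clm_apply ?_) <;>
      fun_prop
    exact hc.integrable_of_hasCompactSupport (HasCompactSupport.of_compactSpace _)
  have hzero : ∀ i j : Fin 3, i ≠ j → ∫ σ, T (EuclideanSpace.single i 1)
      (EuclideanSpace.single j 1) σ ∂(volume : Measure E3).toSphere = 0 := fun i j hij =>
    integral_sphere_rotationGenerator_eq_zero hu hβ (by simp) (by simp)
      (by simp [EuclideanSpace.inner_single_left, hij])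
  have hpd : ∀ (σ : Metric.sphere (0 : E3) 1) (i j : Fin 4),
      pd i (pd j u) (β + s • (timeVec + spaceIncl σ)) = _ := fun σ =>
    pd_pd_eq_fderiv_fderiv (hasFDerivAt_fderiv_Vplus hu (hβ σ)).differentiableAt
  rw [integral_congr_ae (ae_of_all _ fun σ => sum_rotationGenerator_eq (norm_eq_of_mem_sphere σ) s
    _ _ (fderiv_fderiv_comm_Vplus hu (hβ σ)) (by simpa only [box, hpd] using hbox _ (hβ σ))
    (T := fun e f => T e f σ) fun e f => rfl)]
  rw [integral_neg, integral_add (f := fun σ => T _ _ σ + T _ _ σ) ((hint _ _).add (hint _ _))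
      (hint _ _),
    integral_add (hint _ _) (hint _ _), hzero 0 1 (by decide), hzero 0 2 (by decide),
    hzero 1 2 (by decide)]
  simp

/-- A solution of the wave equation in the forward cone is bounded at `β` by its Kirchhoff data on
any sphere of the future light cone of `β`. -/
lemma norm_le_of_kirchhoff_data_le {u : (Fin 4 → ℝ) → ℂ} (hu : ContDiffOn ℝ ∞ u Vplus)
    (hbox : ∀ x ∈ Vplus, box u x = 0) {β : Fin 4 → ℝ}
    (hβ : β ∈ Vplus) {s : ℝ} (hs : 0 ≤ s) {M : ℝ}
    (hM : ∀ x : E3, ‖x‖ = 1 → ‖u (β + s • (timeVec + spaceIncl x))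
      + s * fderiv ℝ u (β + s • (timeVec + spaceIncl x)) (spaceIncl x - timeVec)‖ ≤ M) :
    ‖u β‖ ≤ M := by
  set μ := (volume : Measure E3).toSphere
  let G : ℝ → Metric.sphere (0 : E3) 1 → ℂ := fun s σ => u (β + s • (timeVec + spaceIncl σ))
      + s * fderiv ℝ u (β + s • (timeVec + spaceIncl σ)) (spaceIncl σ - timeVec)
  have hmem : ∀ r : ℝ, 0 ≤ r → ∀ σ : Metric.sphere (0 : E3) 1,
      β + r • (timeVec + spaceIncl σ) ∈ Vplus := fun r hr σ =>
    add_smul_mem_Vplus hβ (posLightlike_timeVec_add_spaceIncl (norm_eq_of_mem_sphere σ)) hr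
  have hγ : Continuous fun p : ℝ × Metric.sphere (0 : E3) 1 =>
    β + p.1 • (timeVec + spaceIncl p.2) := by fun_prop
  have hD0 := hu.continuousOn.comp hγ.continuousOn fun p (hp : p ∈ _ ⁻¹' Vplus) => hp
  have hD1 := (contDiffOn_fderiv_Vplus hu).continuousOn.comp hγ.continuousOn
    fun p (hp : p ∈ _ ⁻¹' Vplus) => hp
  have hD2 := (continuousOn_fderiv_fderiv_Vplus hu).comp hγ.continuousOn
    fun p (hp : p ∈ _ ⁻¹' Vplus) => hp
  have hderiv : ∀ r : ℝ, 0 ≤ r → HasDerivAt (fun r => ∫ σ, G r σ ∂μ) 0 r := fun r hr => by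
    rw [← integral_kirchhoff_deriv_eq_zero hu hbox (hmem r hr)]
    refine hasDerivAt_integral_of_continuousOn μ (isOpen_Vplus.preimage hγ) ?_ ?_
      (F' := fun r σ => fderiv ℝ u (β + r • (timeVec + spaceIncl σ)) (timeVec + spaceIncl σ)
        + (fderiv ℝ u (β + r • (timeVec + spaceIncl σ)) (spaceIncl σ - timeVec)
        + r * fderiv ℝ (fderiv ℝ u) (β + r • (timeVec + spaceIncl σ)) (timeVec + spaceIncl σ)
          (spaceIncl σ - timeVec)))
      (fun p hp => hasDerivAt_kirchhoff_integrand hu hp) (hmem r hr)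
    · exact hD0.add ((by fun_prop : Continuous _).continuousOn.mul (hD1.clm_apply (by fun_prop)))
    · exact (hD1.clm_apply (by fun_prop)).add ((hD1.clm_apply (by fun_prop)).add
        ((by fun_prop : Continuous _).continuousOn.mul
          ((hD2.clm_apply (by fun_prop)).clm_apply (by fun_prop))))
  have hconst := constant_of_has_deriv_right_zero (a := 0) (b := s)
    (fun r hr => (hderiv r hr.1).continuousAt.continuousWithinAt)
    (fun r hr => (hderiv r hr.1).hasDerivWithinAt) s ⟨hs, le_rfl⟩
  have : NeZero μ := ⟨Measure.toSphere_ne_zero _⟩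
  have hμ : 0 < μ.real univ := measureReal_univ_pos
  have h0 : ∫ σ, G 0 σ ∂μ = μ.real univ • u β := by simp [G]
  have h1 : ‖∫ σ, G s σ ∂μ‖ ≤ M * μ.real univ :=
    norm_integral_le_of_norm_le_const (ae_of_all _ fun σ => hM σ (norm_eq_of_mem_sphere σ))
  rw [hconst, h0, norm_smul, Real.norm_of_nonneg hμ.le, mul_comm] at h1
  exact le_of_mul_le_mul_right h1 hμ

/-- The linear functional `x ↦ l·x`. -/
def minkCLM (l : Fin 4 → ℝ) : (Fin 4 → ℝ) →L[ℝ] ℝ :=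
  LinearMap.toContinuousLinearMap
    { toFun := mink l
      map_add' := fun x y => by simp only [mink, Pi.add_apply]; ring
      map_smul' := fun c x => by simp only [mink, Pi.smul_apply, smul_eq_mul, RingHom.id_apply]; ring }

lemma minkCLM_apply (l x : Fin 4 → ℝ) : minkCLM l x = mink l x := rfl

lemma hasFDerivAt_planeWave {h : ℝ → ℂ} (hh : Differentiable ℝ h) (l x : Fin 4 → ℝ) :
    HasFDerivAt (fun x => h (mink l x)) ((minkCLM l).smulRight (deriv h (mink l x))) x :=
  (hh (mink l x)).hasDerivAt.hasFDerivAt.comp x (minkCLM l).hasFDerivAt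

lemma pd_planeWave {h : ℝ → ℂ} (hh : Differentiable ℝ h) (l : Fin 4 → ℝ) (ν : Fin 4) :
    pd ν (fun x => h (mink l x)) = fun x => mink l (Pi.single ν 1) • deriv h (mink l x) := by
  funext x
  rw [pd, (hasFDerivAt_planeWave hh l x).fderiv]
  rfl

lemma box_planeWave {h : ℝ → ℂ} (hh : ContDiff ℝ ∞ h) {l : Fin 4 → ℝ} (hl : mink l l = 0)
    (x : Fin 4 → ℝ) : box (fun x => h (mink l x)) x = 0 := by
  have hd := (contDiff_infty_iff_deriv.1 hh)
  have hd' : Differentiable ℝ (deriv h) := hd.2.differentiable (by simp)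
  have h2 : ∀ ν, pd ν (pd ν fun x => h (mink l x)) x
      = (mink l (Pi.single ν 1)) ^ 2 • deriv (deriv h) (mink l x) := fun ν => by
    rw [pd_planeWave hd.1, pd_planeWave (h := fun r => mink l (Pi.single ν 1) • deriv h r)
      (hd'.fun_const_smul _)]
    simp only [deriv_fun_const_smul _ (hd' _), smul_smul, sq]
  simp only [box, h2, ← sub_smul]
  convert zero_smul ℝ _ using 2
  rw [← hl]
  simp [mink]
  ring

/-- The space of finite superpositions of smooth lightlike plane waves. -/
def planeWaveSpan : Submodule ℂ ((Fin 4 → ℝ) → ℂ) :=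
  Submodule.span ℂ {P | ∃ (l : Fin 4 → ℝ) (h : ℝ → ℂ), PosLightlike l ∧ ContDiff ℝ ∞ h ∧
    P = fun x => h (mink l x)}

lemma planeWave_mem_planeWaveSpan {l : Fin 4 → ℝ} (hl : PosLightlike l) {h : ℝ → ℂ}
    (hh : ContDiff ℝ ∞ h) : (fun x => h (mink l x)) ∈ planeWaveSpan :=
  Submodule.subset_span ⟨l, h, hl, hh, rfl⟩

lemma contDiff_of_mem_planeWaveSpan {P : (Fin 4 → ℝ) → ℂ} (hP : P ∈ planeWaveSpan) :
    ContDiff ℝ ∞ P := by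
  induction hP using Submodule.span_induction with
  | mem P hP =>
    obtain ⟨l, h, -, hh, rfl⟩ := hP
    exact hh.comp (minkCLM l).contDiff
  | zero => exact contDiff_const
  | add P Q _ _ hP hQ => exact hP.add hQ
  | smul c P _ hP => exact hP.const_smul c

lemma box_eq_zero_of_mem_planeWaveSpan {P : (Fin 4 → ℝ) → ℂ} (hP : P ∈ planeWaveSpan)
    (x : Fin 4 → ℝ) : box P x = 0 := by
  have hpd : ∀ {P : (Fin 4 → ℝ) → ℂ}, ContDiff ℝ ∞ P → ∀ ν, ContDiff ℝ ∞ (pd ν P) :=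
    fun {P} hP ν => (hP.fderiv_right (m := ∞) (by simp)).clm_apply contDiff_const
  have hadd : ∀ {P Q : (Fin 4 → ℝ) → ℂ}, ContDiff ℝ ∞ P → ContDiff ℝ ∞ Q → ∀ ν,
      pd ν (P + Q) = pd ν P + pd ν Q := fun {P Q} hP hQ ν => by
    funext x
    simp [pd, fderiv_add (hP.differentiable (by simp) x) (hQ.differentiable (by simp) x)]
  have hsmul : ∀ (c : ℂ) {P : (Fin 4 → ℝ) → ℂ}, ContDiff ℝ ∞ P → ∀ ν,
      pd ν (c • P) = c • pd ν P := fun c {P} hP ν => by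
    funext x
    simp [pd, fderiv_const_smul (hP.differentiable (by simp) x)]
  induction hP using Submodule.span_induction with
  | mem P hP =>
    obtain ⟨l, h, hl, hh, rfl⟩ := hP
    exact box_planeWave hh hl.2.1 x
  | zero =>
    have h0 : ∀ ν, pd ν (0 : (Fin 4 → ℝ) → ℂ) = 0 := fun ν => by
      funext x; simp [pd]
    simp [box, h0]
  | add P Q hPm hQm hP hQ =>
    have hP' := contDiff_of_mem_planeWaveSpan hPm
    have hQ' := contDiff_of_mem_planeWaveSpan hQm
    simp only [box, hadd hP' hQ', hadd (hpd hP' _) (hpd hQ' _), Pi.add_apply] at *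
    linear_combination hP + hQ
  | smul c P hPm hP =>
    have hP' := contDiff_of_mem_planeWaveSpan hPm
    simp only [box, hsmul c hP', hsmul c (hpd hP' _), Pi.smul_apply, smul_eq_mul] at *
    linear_combination c * hP

lemma exists_restrict_mem_evenLightlikeClosure {B : Set (Fin 4 → ℝ)} [CompactSpace B]
    (hBV : B ⊆ Vplus) {P : (Fin 4 → ℝ) → ℂ} (hP : P ∈ planeWaveSpan) :
    ∃ g ∈ evenLightlikeClosure B, ∀ β : B, g β = P β := by
  induction hP using Submodule.span_induction with
  | mem P hP =>
    obtain ⟨l, h, hl, hh, rfl⟩ := hP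
    exact ⟨⟨fun β => h (mink l β), hh.continuous.comp
        ((continuous_mink_right l).comp continuous_subtype_val)⟩,
      planeWave_mem_evenLightlikeClosure hBV hl hh.continuous _ fun _ => rfl, fun _ => rfl⟩
  | zero => exact ⟨0, Submodule.zero_mem _, fun _ => rfl⟩
  | add P Q _ _ hP hQ =>
    obtain ⟨g, hg, hgP⟩ := hP
    obtain ⟨g', hg', hgQ⟩ := hQ
    exact ⟨g + g', Submodule.add_mem _ hg hg', fun β => by simp [hgP, hgQ]⟩
  | smul c P _ hP =>
    obtain ⟨g, hg, hgP⟩ := hP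
    exact ⟨c • g, Submodule.smul_mem _ c hg, fun β => by simp [hgP]⟩

lemma mink_timeVec_add_spaceIncl (w y : E3) (a b : ℝ) :
    mink (timeVec + spaceIncl w) (a • timeVec + b • spaceIncl y) = a - b * inner ℝ w y := by
  rw [PiLp.inner_apply, Fin.sum_univ_three]
  simp [mink, timeVec, spaceIncl_apply]
  ring

lemma exists_norm_eq_one_smul_eq (k : E3) : ∃ (w : E3) (κ : ℝ), ‖w‖ = 1 ∧ k = κ • w := by
  by_cases hk : k = 0
  · exact ⟨EuclideanSpace.single 0 1, 0, by simp, by simp [hk]⟩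
  · exact ⟨‖k‖⁻¹ • k, ‖k‖, norm_smul_inv_norm hk, by
      rw [smul_inv_smul₀ (norm_ne_zero_iff.2 hk)]⟩

/-- The superposition `(F (⟪w, y⟫ + τ) + a F (⟪w, y⟫ - τ)) / 2` of two plane waves travelling in
opposite directions, with its Cauchy data at `τ = 0`. -/
lemma exists_planeWaveSpan_cauchyData {w : E3} (hw : ‖w‖ = 1) {F : ℝ → ℂ} (hF : ContDiff ℝ ∞ F)
    (a : ℂ) (T : ℝ) :
    ∃ P ∈ planeWaveSpan, ∀ y : E3, P (T • timeVec + spaceIncl y) = (1 + a) / 2 * F (inner ℝ w y) ∧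
      ∀ (b : ℝ) (v : E3), fderiv ℝ P (T • timeVec + spaceIncl y) (b • timeVec + spaceIncl v)
        = ((1 - a) / 2 * b + (1 + a) / 2 * (inner ℝ w v : ℝ)) * deriv F (inner ℝ w y) := by
  have hd := contDiff_infty_iff_deriv.1 hF
  have hF1 : ContDiff ℝ ∞ fun r => F (r - T) := hF.comp (by fun_prop)
  have hF2 : ContDiff ℝ ∞ fun r => F (T - r) := hF.comp (by fun_prop)
  refine ⟨_, Submodule.add_mem _
    (Submodule.smul_mem _ (1 / 2) (planeWave_mem_planeWaveSpan
      (posLightlike_timeVec_add_spaceIncl (x := -w) (by rwa [norm_neg])) hF1))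
    (Submodule.smul_mem _ (a / 2) (planeWave_mem_planeWaveSpan
      (posLightlike_timeVec_add_spaceIncl hw) hF2)), fun y => ⟨?_, fun b v => ?_⟩⟩
  · have h1 := mink_timeVec_add_spaceIncl (-w) y T 1
    have h2 := mink_timeVec_add_spaceIncl w y T 1
    simp only [one_smul, one_mul] at h1 h2
    simp only [Pi.add_apply, Pi.smul_apply, h1, h2, smul_eq_mul, inner_neg_left]
    ring_nf
  · have h1 := mink_timeVec_add_spaceIncl (-w) y T 1
    have h2 := mink_timeVec_add_spaceIncl w y T 1
    have h3 := mink_timeVec_add_spaceIncl (-w) v b 1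
    have h4 := mink_timeVec_add_spaceIncl w v b 1
    simp only [one_smul, one_mul] at h1 h2 h3 h4
    have hA := (hasFDerivAt_planeWave (hF1.differentiable (by simp)) (timeVec + spaceIncl (-w))
      (T • timeVec + spaceIncl y)).const_smul (1 / 2 : ℂ)
    have hB := (hasFDerivAt_planeWave (hF2.differentiable (by simp)) (timeVec + spaceIncl w)
      (T • timeVec + spaceIncl y)).const_smul (a / 2)
    rw [deriv_comp_sub_const, h1] at hA
    rw [deriv_comp_const_sub, h2] at hB
    rw [(hA.add hB).fderiv]
    simp only [add_apply, smul_apply, ContinuousLinearMap.smulRight_apply,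
      minkCLM_apply, h3, h4, smul_eq_mul, inner_neg_left, Complex.real_smul]
    simp
    ring

lemma hasDerivAt_cexp_ofReal_mul_I (κ r : ℝ) :
    HasDerivAt (fun r : ℝ => Complex.exp (↑(κ * r) * Complex.I))
      (κ * Complex.I * Complex.exp (↑(κ * r) * Complex.I)) r := by
  have h : HasDerivAt (fun r : ℝ => (↑(κ * r) : ℂ) * Complex.I) (κ * Complex.I) r := by
    simpa using (((hasDerivAt_id r).const_mul κ).ofReal_comp).mul_const Complex.I
  simpa [mul_comm] using h.cexp

lemma contDiff_cexp_ofReal_mul_I (κ : ℝ) :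
    ContDiff ℝ ∞ fun r : ℝ => Complex.exp (↑(κ * r) * Complex.I) :=
  (((Complex.ofRealCLM.contDiff.comp (contDiff_const.mul contDiff_id)).mul contDiff_const)).cexp

lemma expWave_eq {k w : E3} {κ : ℝ} (hk : (2 * Real.pi) • k = κ • w) (y : E3) :
    expWave k y = Complex.exp (↑(κ * inner ℝ w y) * Complex.I) := by
  rw [expWave, ← real_inner_smul_left, hk, real_inner_smul_left]

/-- A solution of the wave equation with Cauchy data `(expWave k, 0)` at time `T`. -/
lemma exists_planeWaveSpan_position (k : E3) (T : ℝ) :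
    ∃ P ∈ planeWaveSpan, ∀ y : E3, P (T • timeVec + spaceIncl y) = expWave k y ∧
      ∀ (b : ℝ) (v : E3), fderiv ℝ P (T • timeVec + spaceIncl y) (b • timeVec + spaceIncl v)
        = jetWave k (y, 0, v) := by
  obtain ⟨w, κ, hw, hk⟩ := exists_norm_eq_one_smul_eq ((2 * Real.pi) • k)
  obtain ⟨P, hP, h⟩ := exists_planeWaveSpan_cauchyData hw (contDiff_cexp_ofReal_mul_I κ) 1 T
  refine ⟨P, hP, fun y => ⟨by rw [(h y).1, expWave_eq hk]; ring, fun b v => ?_⟩⟩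
  have h1 : (2 * Real.pi * inner ℝ k v : ℂ) = κ * (inner ℝ w v : ℝ) := by
    have := congrArg (fun z => inner ℝ z v) hk
    simp only [real_inner_smul_left] at this
    exact_mod_cast this
  rw [(h y).2, (hasDerivAt_cexp_ofReal_mul_I κ _).deriv, jetWave, expWave_eq hk]
  push_cast
  linear_combination -Complex.I * Complex.exp (κ * (inner ℝ w y : ℝ) * Complex.I) * h1

/-- A solution of the wave equation with Cauchy data `(0, expWave k)` at time `T`. -/
lemma exists_planeWaveSpan_velocity (k : E3) (T : ℝ) :
    ∃ P ∈ planeWaveSpan, ∀ y : E3, P (T • timeVec + spaceIncl y) = 0 ∧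
      ∀ (b : ℝ) (v : E3), fderiv ℝ P (T • timeVec + spaceIncl y) (b • timeVec + spaceIncl v)
        = b * expWave k y := by
  obtain ⟨w, κ, hw, hk⟩ := exists_norm_eq_one_smul_eq ((2 * Real.pi) • k)
  let f : ℝ → ℂ := fun r => Complex.exp (↑(κ * r) * Complex.I)
  have hf : ContDiff ℝ ∞ f := contDiff_cexp_ofReal_mul_I κ
  have hd : ∀ r, HasDerivAt (fun r => ∫ t in (0 : ℝ)..r, f t) (f r) r := fun r =>
    hf.continuous.integral_hasStrictDerivAt 0 r |>.hasDerivAt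
  have hF : ContDiff ℝ ∞ fun r => ∫ t in (0 : ℝ)..r, f t := by
    rw [contDiff_infty_iff_deriv]
    exact ⟨fun r => (hd r).differentiableAt, by rwa [funext fun r => (hd r).deriv]⟩
  obtain ⟨P, hP, h⟩ := exists_planeWaveSpan_cauchyData hw hF (-1) T
  refine ⟨P, hP, fun y => ⟨by rw [(h y).1]; ring, fun b v => ?_⟩⟩
  rw [(h y).2, (hd _).deriv, expWave_eq hk]
  ring

/-- Superpositions of plane waves with prescribed trigonometric Cauchy data at time `T`. -/
lemma exists_planeWaveSpan_trig {N N' : ℕ} (c : Fin N → ℂ) (k : Fin N → E3) (c' : Fin N' → ℂ)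
    (k' : Fin N' → E3) (T : ℝ) :
    ∃ P ∈ planeWaveSpan, ∀ y : E3,
      P (T • timeVec + spaceIncl y) = ∑ j, c j * expWave (k j) y ∧
      ∀ (b : ℝ) (v : E3), fderiv ℝ P (T • timeVec + spaceIncl y) (b • timeVec + spaceIncl v)
        = ∑ j, c j * jetWave (k j) (y, 0, v) + b * ∑ j, c' j * expWave (k' j) y := by
  choose P hP hPd using fun j => exists_planeWaveSpan_position (k j) T
  choose Q hQ hQd using fun j => exists_planeWaveSpan_velocity (k' j) T
  refine ⟨∑ j, c j • P j + ∑ j, c' j • Q j, Submodule.add_mem _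
    (Submodule.sum_mem _ fun j _ => Submodule.smul_mem _ _ (hP j))
    (Submodule.sum_mem _ fun j _ => Submodule.smul_mem _ _ (hQ j)), fun y => ⟨?_, fun b v => ?_⟩⟩
  · simp [(hPd _ y).1, (hQd _ y).1]
  · have hd : ∀ {R : (Fin 4 → ℝ) → ℂ}, R ∈ planeWaveSpan → ∀ x,
        HasFDerivAt R (fderiv ℝ R x) x := fun hR x =>
      ((contDiff_of_mem_planeWaveSpan hR).differentiable (by simp) x).hasFDerivAt
    have h := (HasFDerivAt.sum (u := Finset.univ) fun j _ =>
      (hd (hP j) (T • timeVec + spaceIncl y)).const_smul (c j)).add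
      (HasFDerivAt.sum (u := Finset.univ) fun j _ =>
      (hd (hQ j) (T • timeVec + spaceIncl y)).const_smul (c' j))
    rw [h.fderiv]
    simp [-map_add, -map_smul, (hPd _ y).2, (hQd _ y).2, Finset.mul_sum, mul_left_comm]

lemma timeVec_add_spaceIncl_mem_Vplus {T : ℝ} {y : E3} (hy : ‖y‖ < T) :
    T • timeVec + spaceIncl y ∈ Vplus := by
  have hT : 0 < T := (norm_nonneg y).trans_lt hy
  have h : ‖y‖ ^ 2 < T ^ 2 := pow_lt_pow_left₀ hy (norm_nonneg y) two_ne_zero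
  rw [norm_sq_E3] at h
  refine ⟨by simpa [timeVec, spaceIncl_apply] using hT, ?_⟩
  simp [mink, timeVec, spaceIncl_apply]
  linarith

/-- Cutting off the restriction to a slice of the forward cone. -/
lemma exists_cutoff_slice {ψ : (Fin 4 → ℝ) → ℂ} (hψ : ContDiffOn ℝ ∞ ψ Vplus) {R T : ℝ}
    (hR : 0 < R) (hRT : R < T) :
    ∃ φ : E3 → ℂ, ContDiff ℝ ∞ φ ∧ HasCompactSupport φ ∧
      ∀ y, ‖y‖ ≤ R → φ =ᶠ[𝓝 y] fun y => ψ (T • timeVec + spaceIncl y) := by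
  let χ : ContDiffBump (0 : E3) := ⟨(2 * R + T) / 3, (R + 2 * T) / 3, by linarith, by linarith⟩
  have hγ : ContDiff ℝ ∞ fun y : E3 => T • timeVec + spaceIncl y := by fun_prop
  have hc : HasCompactSupport fun y => (χ y : ℂ) * ψ (T • timeVec + spaceIncl y) :=
    (χ.hasCompactSupport.comp_left (g := fun r : ℝ => (r : ℂ)) Complex.ofReal_zero).mul_right
  refine ⟨fun y => (χ y : ℂ) * ψ (T • timeVec + spaceIncl y), ?_, hc, fun y hy => ?_⟩
  · refine contMDiff_iff_contDiff.1 (contMDiff_of_tsupport fun y hy => ContDiffAt.contMDiffAt ?_)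
    have hy' : y ∈ tsupport χ := by
      refine closure_mono (fun z hz => ?_) hy
      rw [Function.mem_support] at hz ⊢
      exact fun h0 => hz (by simp [h0])
    rw [χ.tsupport_eq, mem_closedBall_zero_iff] at hy'
    have hmem : T • timeVec + spaceIncl y ∈ Vplus :=
      timeVec_add_spaceIncl_mem_Vplus (hy'.trans_lt (by simp only [χ]; linarith))
    exact (Complex.ofRealCLM.contDiff.contDiffAt.comp y χ.contDiffAt).mul
      ((hψ.contDiffAt (isOpen_Vplus.mem_nhds hmem)).comp y hγ.contDiffAt)
  · have : Metric.ball (0 : E3) χ.rIn ∈ 𝓝 y := Metric.isOpen_ball.mem_nhds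
      (mem_ball_zero_iff.2 (hy.trans_lt (by simp only [χ]; linarith)))
    filter_upwards [this] with z hz
    rw [χ.one_of_mem_closedBall (Metric.ball_subset_closedBall hz)]
    simp

/-- A solution of the wave equation in the forward cone is, together with its first derivatives,
approximated on a slice by superpositions of plane waves. -/
lemma exists_planeWaveSpan_near_on_slice {u : (Fin 4 → ℝ) → ℂ} (hu : ContDiffOn ℝ ∞ u Vplus)
    {R T : ℝ} (hR : 1 ≤ R) (hRT : R < T) {ε : ℝ} (hε : 0 < ε) :
    ∃ P ∈ planeWaveSpan, ∀ y : E3, ‖y‖ ≤ R →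
      ‖u (T • timeVec + spaceIncl y) - P (T • timeVec + spaceIncl y)‖ ≤ ε ∧
      ∀ v : E3, ‖v‖ ≤ 1 → ‖fderiv ℝ u (T • timeVec + spaceIncl y) (spaceIncl v - timeVec)
        - fderiv ℝ P (T • timeVec + spaceIncl y) (spaceIncl v - timeVec)‖ ≤ 2 * ε := by
  have hR0 : 0 < R := one_pos.trans_le hR
  obtain ⟨φ, hφ, hφc, hφu⟩ := exists_cutoff_slice hu hR0 hRT
  obtain ⟨φ', hφ', hφc', hφu'⟩ := exists_cutoff_slice
    ((contDiffOn_fderiv_Vplus hu).clm_apply (contDiffOn_const (c := timeVec))) hR0 hRT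
  obtain ⟨N, c, k, hN⟩ := exists_expWave_sum_near hR hφ hφc hε
  obtain ⟨N', c', k', hN'⟩ := exists_expWave_sum_near hR hφ' hφc' hε
  obtain ⟨P, hP, hPd⟩ := exists_planeWaveSpan_trig c k c' k' T
  refine ⟨P, hP, fun y hy => ⟨?_, fun v hv => ?_⟩⟩
  · rw [(hPd y).1, ← (hφu y hy).eq_of_nhds]
    exact (hN y 0 hy (by simp)).1
  · have hd : fderiv ℝ φ y v = fderiv ℝ u (T • timeVec + spaceIncl y) (spaceIncl v) := by
      have h1 : HasFDerivAt (fun y : E3 => T • timeVec + spaceIncl y) spaceIncl y :=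
        spaceIncl.hasFDerivAt.const_add _
      have h2 := ((hu.differentiableOn (by simp)).differentiableAt (isOpen_Vplus.mem_nhds
        (timeVec_add_spaceIncl_mem_Vplus (hy.trans_lt hRT)))).hasFDerivAt.comp y h1
      rw [(hφu y hy).fderiv_eq]
      exact congrArg (fun L => L v) h2.fderiv
    have hP1 := (hPd y).2 (-1) v
    rw [neg_one_smul, neg_add_eq_sub] at hP1
    rw [hP1, map_sub, ← hd, ← (hφu' y hy).eq_of_nhds]
    calc _ = ‖(fderiv ℝ φ y v - ∑ j, c j * jetWave (k j) (y, 0, v))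
          - (φ' y - ∑ j, c' j * expWave (k' j) y)‖ := by
          congr 1
          push_cast
          ring
      _ ≤ ε + ε := norm_sub_le_of_le (hN y v hy hv).2 (hN' y 0 hy (by simp)).1
      _ = 2 * ε := by ring

lemma smul_timeVec_add_spaceIncl (β : Fin 4 → ℝ) :
    β 0 • timeVec + spaceIncl !₂[β 1, β 2, β 3] = β := by
  ext i; fin_cases i <;> simp [timeVec, spaceIncl_apply]

lemma norm_lt_of_mem_Vplus {β : Fin 4 → ℝ} (hβ : β ∈ Vplus) : ‖(!₂[β 1, β 2, β 3] : E3)‖ < β 0 := by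
  refine lt_of_pow_lt_pow_left₀ 2 hβ.1.le ?_
  have := hβ.2
  rw [norm_sq_E3]
  simp [mink] at this ⊢
  linarith

/-- Superpositions of plane waves are dense among the solutions of the wave equation. -/
lemma exists_planeWaveSpan_near {u : (Fin 4 → ℝ) → ℂ} (hu : ContDiffOn ℝ ∞ u Vplus)
    (hbox : ∀ x ∈ Vplus, box u x = 0) {B : Set (Fin 4 → ℝ)} (hB : IsCompact B) (hBV : B ⊆ Vplus)
    {ε : ℝ} (hε : 0 < ε) : ∃ P ∈ planeWaveSpan, ∀ β ∈ B, ‖u β - P β‖ ≤ ε := by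
  rcases B.eq_empty_or_nonempty with rfl | hne
  · exact ⟨0, Submodule.zero_mem _, by simp⟩
  have hcont : Continuous fun β : Fin 4 → ℝ => β 0 - ‖(!₂[β 1, β 2, β 3] : E3)‖ := by
    refine (continuous_apply 0).sub (Continuous.norm ?_)
    refine (PiLp.continuous_toLp 2 _).comp (continuous_pi fun i => ?_)
    fin_cases i <;> simp <;> fun_prop
  obtain ⟨β₀, hβ₀, hmin⟩ := hB.exists_isMinOn hne hcont.continuousOn
  obtain ⟨M, hM⟩ := (hB.image (continuous_apply (0 : Fin 4))).bddAbove
  have hδ : 0 < β₀ 0 - ‖(!₂[β₀ 1, β₀ 2, β₀ 3] : E3)‖ := sub_pos.2 (norm_lt_of_mem_Vplus (hBV hβ₀))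
  set δ := β₀ 0 - ‖(!₂[β₀ 1, β₀ 2, β₀ 3] : E3)‖
  set T := max M 0 + 1 + δ with hT
  have hT0 : 0 < T := by have := le_max_right M 0; linarith
  have hε' : 0 < ε / (1 + 2 * T) := by positivity
  obtain ⟨P, hP, hPu⟩ := exists_planeWaveSpan_near_on_slice hu (R := T - δ) (T := T)
    (by have := le_max_right M 0; linarith) (by linarith) hε'
  refine ⟨P, hP, fun β hβ => ?_⟩
  have hPs := contDiff_of_mem_planeWaveSpan hP
  have hβT : β 0 ≤ T := (hM ⟨β, hβ, rfl⟩).trans (by have := le_max_left M 0; linarith)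
  have hβδ : ‖(!₂[β 1, β 2, β 3] : E3)‖ ≤ β 0 - δ := by
    have : δ ≤ β 0 - ‖(!₂[β 1, β 2, β 3] : E3)‖ := hmin hβ
    linarith
  have hs : 0 ≤ T - β 0 := sub_nonneg.2 hβT
  have hdiff : ∀ x ∈ Vplus, fderiv ℝ (u - P) x = fderiv ℝ u x - fderiv ℝ P x := fun x hx =>
    fderiv_sub ((hu.differentiableOn (by simp)).differentiableAt (isOpen_Vplus.mem_nhds hx))
      (hPs.differentiable (by simp) x)
  have hsub : ContDiffOn ℝ ∞ (u - P) Vplus := hu.sub hPs.contDiffOn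
  have hbox' : ∀ x ∈ Vplus, box (u - P) x = 0 := fun x hx => by
    have hpd2 : ∀ i, pd i (pd i (u - P)) x = pd i (pd i u) x - pd i (pd i P) x := fun i => by
      have h1 := (hasFDerivAt_fderiv_Vplus hu hx).differentiableAt
      have h2 := (hasFDerivAt_fderiv_Vplus hPs.contDiffOn hx).differentiableAt
      have h3 := (hasFDerivAt_fderiv_Vplus hsub hx).differentiableAt
      have h4 : fderiv ℝ (u - P) =ᶠ[𝓝 x] fderiv ℝ u - fderiv ℝ P := by
        filter_upwards [isOpen_Vplus.mem_nhds hx] with z hz using hdiff z hz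
      rw [pd_pd_eq_fderiv_fderiv h1, pd_pd_eq_fderiv_fderiv h2, pd_pd_eq_fderiv_fderiv h3,
        h4.fderiv_eq, fderiv_sub h1 h2]
      rfl
    have h1 := hbox x hx
    have h2 := box_eq_zero_of_mem_planeWaveSpan hP x
    simp only [box, hpd2] at *
    linear_combination h1 - h2
  refine norm_le_of_kirchhoff_data_le hsub hbox' (hBV hβ) hs fun x hx => ?_
  have hγ : β + (T - β 0) • (timeVec + spaceIncl x)
      = T • timeVec + spaceIncl (!₂[β 1, β 2, β 3] + (T - β 0) • x) := by
    nth_rw 1 [← smul_timeVec_add_spaceIncl β]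
    rw [map_add, map_smul]
    module
  have hy : ‖(!₂[β 1, β 2, β 3] : E3) + (T - β 0) • x‖ ≤ T - δ := by
    refine (norm_add_le _ _).trans ?_
    rw [norm_smul, hx, Real.norm_of_nonneg hs]
    linarith
  obtain ⟨h1, h2⟩ := hPu _ hy
  have hmem := add_smul_mem_Vplus (hBV hβ) (posLightlike_timeVec_add_spaceIncl hx) hs
  change ‖u _ - P _ + _ * fderiv ℝ (u - P) _ _‖ ≤ ε
  rw [hdiff _ hmem, hγ]
  refine (norm_add_le _ _).trans ?_
  rw [norm_mul, Complex.norm_real, Real.norm_of_nonneg hs]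
  have h3 : (T - β 0) * ‖fderiv ℝ u _ (spaceIncl x - timeVec) - fderiv ℝ P _
      (spaceIncl x - timeVec)‖ ≤ T * (2 * (ε / (1 + 2 * T))) :=
    mul_le_mul (by linarith [(hBV hβ).1]) (h2 x hx.le) (norm_nonneg _) hT0.le
  refine (add_le_add h1 h3).trans (le_of_eq ?_)
  field_simp

/-- The linear span of the even powers β ↦ (l·β)^m (m even, l positive
lightlike) is dense in the smooth solutions of the wave equation on V₊,
with respect to uniform convergence on compact subsets of V₊. -/
theorem even_lightlike_powers_dense_in_wave_solutions
    (Ξ : (Fin 4 → ℝ) → ℂ) (hΞ : ContDiffOn ℝ (⊤ : ℕ∞) Ξ Vplus)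
    (hwave : ∀ β ∈ Vplus, box Ξ β = 0)
    (B : Set (Fin 4 → ℝ)) (hB : IsCompact B) (hBV : B ⊆ Vplus)
    (ε : ℝ) (hε : 0 < ε) :
    ∃ (N : ℕ) (l : Fin N → (Fin 4 → ℝ)) (m : Fin N → ℕ) (c : Fin N → ℂ),
      (∀ j, PosLightlike (l j)) ∧ (∀ j, Even (m j)) ∧
      (⨆ β : B, ‖Ξ (β : Fin 4 → ℝ)
        - ∑ j, c j * ((mink (l j) (β : Fin 4 → ℝ) ^ (m j) : ℝ) : ℂ)‖) < ε := by
  obtain ⟨P, hP, hPΞ⟩ := exists_planeWaveSpan_near hΞ hwave hB hBV (ε := ε / 4) (by positivity)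
  have : CompactSpace B := isCompact_iff_compactSpace.1 hB
  obtain ⟨g, hg, hgP⟩ := exists_restrict_mem_evenLightlikeClosure hBV hP
  obtain ⟨N, c, q, hq, hN⟩ := exists_sum_near_of_mem_topologicalClosure_span hg
    (ε := ε / 4) (by positivity)
  choose l m hl hm hlm using hq
  refine ⟨N, l, m, c, hl, hm, ?_⟩
  refine (Real.iSup_le (fun β => ?_) (by positivity)).trans_lt (half_lt_self hε)
  have h1 := hPΞ β β.2
  have h2 := ((g - ∑ i, c i • q i).norm_coe_le_norm β).trans hN.le
  rw [ContinuousMap.sub_apply, ContinuousMap.sum_apply, hgP] at h2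
  simp only [ContinuousMap.smul_apply, smul_eq_mul, hlm] at h2
  calc _ ≤ _ := norm_sub_le_norm_sub_add_norm_sub _ (P β) _
    _ ≤ ε / 4 + ε / 4 := add_le_add h1 h2
    _ = ε / 2 := by ring
end
end
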